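/- arXiv:2512.10518 — 13 statements merged into one kernel-verified Lean document; each statement's English description precedes it below -/
import Mathlib

section
/- Let P ⊆ ℝ^n be a lattice polytope whose affine hull has dimension d ≥ 1. Then the relative interior of the dilate (d+1)•P contains at least one point of ℤ^n, and the relative interior of the dilate (d+2)•P contains at least two distinct points of ℤ^n. -/
open Pointwise

theorem cont_aux {n : ℕ} (A : AffineSubspace ℝ (Fin n → ℝ)) [hne : Nonempty A]
    (f : A →ᵃ[ℝ] ℝ) : Continuous f := by
  obtain ⟨y0⟩ := id hne
  have hl : Continuous f.linear := f.linear.continuous_of_finiteDimensional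
  have h : (f : A → ℝ) = fun y => f.linear (y -ᵥ y0) + f y0 := by
    funext y
    rw [AffineMap.linearMap_vsub]
    simp
  rw [h]
  refine (hl.comp ?_).add continuous_const
  refine Continuous.subtype_mk (f := fun y : A => (y : Fin n → ℝ) - (y0 : Fin n → ℝ)) ?_ _
  exact continuous_subtype_val.sub continuous_const

theorem core_aux {n : ℕ} (V : Finset (Fin n → ℝ)) (hV : V.Nonempty)
    (Q : Set (Fin n → ℝ)) (hVQ : (V : Set (Fin n → ℝ)) ⊆ Q) (hQ : Convex ℝ Q)
    (A : AffineSubspace ℝ (Fin n → ℝ)) (hA : A = affineSpan ℝ Q)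
    (hA' : A = affineSpan ℝ (V : Set (Fin n → ℝ))) :
    ∃ (ι : Type) (_ : Fintype ι) (p : ι → (Fin n → ℝ)), Function.Injective p ∧
      (∀ i, p i ∈ V) ∧ Fintype.card ι = Module.finrank ℝ A.direction + 1 ∧
      ∀ w : ι → ℝ, (∀ i, 0 < w i) → ∑ i, w i = 1 →
        ∑ i, w i • p i ∈ intrinsicInterior ℝ Q := by
  have hne : Nonempty (V : Set (Fin n → ℝ)) := hV.to_subtype
  have hneA : Nonempty A := by
    subst hA'
    obtain ⟨v, hv⟩ := hV
    exact ⟨⟨v, subset_affineSpan ℝ _ hv⟩⟩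
  have htop : affineSpan ℝ (((↑) : A → (Fin n → ℝ)) ⁻¹' (V : Set (Fin n → ℝ))) = ⊤ := by
    subst hA'
    exact affineSpan_coe_preimage_eq_top _
  obtain ⟨s, hst, b, hb⟩ := AffineBasis.exists_affine_subbasis htop
  have hfin : s.Finite :=
    (V.finite_toSet.preimage Subtype.val_injective.injOn).subset hst
  have : Fintype s := hfin.fintype
  have hfd : FiniteDimensional ℝ A.direction := inferInstance
  have hcont : ∀ i, Continuous (b.coord i) := fun i => cont_aux A _
  have key : ∀ w : s → ℝ, ∑ i, w i = 1 →
      ((Finset.univ.affineCombination ℝ b w : A) : Fin n → ℝ) = ∑ i, w i • ((i : A) : Fin n → ℝ) := by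
    intro w hw
    have := Finset.univ.map_affineCombination b w hw A.subtype
    have h2 := this.trans (Finset.univ.affineCombination_eq_linear_combination _ _ hw)
    rw [hb] at h2 ⊢
    exact h2
  refine ⟨s, inferInstance, fun i => ((i : A) : Fin n → ℝ), ?_, ?_, ?_, ?_⟩
  · exact Subtype.val_injective.comp Subtype.val_injective
  · intro i
    exact hst i.2
  · exact b.card_eq_finrank_add_one
  · intro w hw0 hw1
    have hint : Finset.univ.affineCombination ℝ b w ∈
        interior (((↑) : A → (Fin n → ℝ)) ⁻¹' Q) := by
      rw [mem_interior]
      refine ⟨⋂ i, b.coord i ⁻¹' Set.Ioi 0, ?_, ?_, ?_⟩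
      · intro y hy
        rw [Set.mem_iInter] at hy
        have h1 := b.sum_coord_apply_eq_one y
        have h2 := key (fun i => b.coord i y) h1
        rw [b.affineCombination_coord_eq_self] at h2
        rw [Set.mem_preimage, h2]
        exact hQ.sum_mem (fun i _ => (hy i).le) h1 (fun i _ => hVQ (hst i.2))
      · exact isOpen_iInter_of_finite fun i => isOpen_Ioi.preimage (hcont i)
      · rw [Set.mem_iInter]
        intro i
        rw [Set.mem_preimage, b.coord_apply_combination_of_mem (Finset.mem_univ i) hw1]
        exact hw0 i
    rw [← key w hw1]
    subst hA
    exact mem_intrinsicInterior.2 ⟨_, hint, rfl⟩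

theorem smul_aux {n : ℕ} (Q : Set (Fin n → ℝ)) (c : ℝ) (hc : c ≠ 0) (x : Fin n → ℝ)
    (hx : c⁻¹ • x ∈ intrinsicInterior ℝ Q) : x ∈ intrinsicInterior ℝ (c • Q) := by
  have h := AffineEquiv.intrinsicInterior_image
    (LinearEquiv.smulOfNeZero ℝ (Fin n → ℝ) c hc).toAffineEquiv Q
  have h2 : (LinearEquiv.smulOfNeZero ℝ (Fin n → ℝ) c hc).toAffineEquiv '' Q = c • Q := rfl
  rw [← h2, h]
  refine ⟨_, hx, ?_⟩
  change c • c⁻¹ • x = x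
  exact smul_inv_smul₀ hc x



/-- Let `P ⊆ ℝ^n` be a lattice polytope (convex hull of a finite nonempty
set of integer points) whose affine hull has dimension `d ≥ 1`. Then the relative interior
of `(d+1)•P` contains at least one integer point, and the relative interior of `(d+2)•P`
contains at least two distinct integer points. -/
theorem stmt0 (n : ℕ) (V : Finset (Fin n → ℝ)) (hV : V.Nonempty)
    (hVint : ∀ v ∈ V, ∀ i, ∃ m : ℤ, v i = (m : ℝ))
    (P : Set (Fin n → ℝ)) (hP : P = convexHull ℝ (V : Set (Fin n → ℝ)))
    (d : ℕ) (hd : 1 ≤ d)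
    (hdim : Module.finrank ℝ (affineSpan ℝ P).direction = d) :
    (∃ x ∈ intrinsicInterior ℝ ((((d : ℕ) + 1 : ℕ) : ℝ) • P),
        ∀ i, ∃ m : ℤ, x i = (m : ℝ)) ∧
    (∃ x ∈ intrinsicInterior ℝ ((((d : ℕ) + 2 : ℕ) : ℝ) • P),
      ∃ y ∈ intrinsicInterior ℝ ((((d : ℕ) + 2 : ℕ) : ℝ) • P),
        x ≠ y ∧ (∀ i, ∃ m : ℤ, x i = (m : ℝ)) ∧ (∀ i, ∃ m : ℤ, y i = (m : ℝ))) := by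
  subst hP
  obtain ⟨ι, _, p, hinj, hpV, hcard, hint⟩ := core_aux V hV _ (subset_convexHull ℝ _)
    (convex_convexHull ℝ _) _ rfl (affineSpan_convexHull _)
  rw [hdim] at hcard
  classical
  have gen : ∀ (c : ℝ) (w : ι → ℝ), 0 < c → (∀ i, 0 < w i) → ∑ i, w i = c →
      ∑ i, w i • p i ∈ intrinsicInterior ℝ (c • convexHull ℝ (V : Set (Fin n → ℝ))) := by
    intro c w hc hw hs
    apply smul_aux _ _ hc.ne'
    have := hint (fun i => c⁻¹ * w i) (fun i => mul_pos (inv_pos.2 hc) (hw i))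
      (by rw [← Finset.mul_sum, hs, inv_mul_cancel₀ hc.ne'])
    simpa only [Finset.smul_sum, mul_smul] using this
  have hsumint : ∀ i, ∃ m : ℤ, (∑ k, p k) i = (m : ℝ) := by
    intro i
    choose m hm using fun k => hVint (p k) (hpV k) i
    exact ⟨∑ k, m k, by simp [Finset.sum_apply, hm]⟩
  have two : ∀ j, ((∑ k, p k) + p j) ∈ intrinsicInterior ℝ
      ((((d : ℕ) + 2 : ℕ) : ℝ) • convexHull ℝ (V : Set (Fin n → ℝ))) := by
    intro j
    have := gen ((d + 2 : ℕ) : ℝ) (fun i => 1 + if i = j then 1 else 0) (by positivity)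
      (fun i => by positivity)
      (by simp [Finset.sum_add_distrib, hcard]; ring)
    simpa only [add_smul, Finset.sum_add_distrib, one_smul, ite_smul, zero_smul,
      Finset.sum_ite_eq', Finset.mem_univ, if_true] using this
  have twoint : ∀ j, ∀ i, ∃ m : ℤ, ((∑ k, p k) + p j) i = (m : ℝ) := by
    intro j i
    obtain ⟨a, ha⟩ := hsumint i
    obtain ⟨b, hb⟩ := hVint (p j) (hpV j) i
    exact ⟨a + b, by rw [Pi.add_apply, ha, hb]; push_cast; rfl⟩
  constructor
  · refine ⟨∑ k, p k, ?_, hsumint⟩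
    have := gen ((d + 1 : ℕ) : ℝ) (fun _ => 1) (by positivity) (fun _ => one_pos)
      (by simp [hcard])
    simpa only [one_smul] using this
  · have : 1 < Fintype.card ι := by omega
    obtain ⟨j, k, hjk⟩ := Fintype.one_lt_card_iff.1 this
    exact ⟨_, two j, _, two k, fun h => hjk (hinj (add_left_cancel h)), twoint j, twoint k⟩
end

section
/- Let P ⊆ ℝ^n be a lattice polytope whose affine hull has dimension d ≥ 1. Then for every integer k ≥ 1, the number of points of ℤ^n lying in the relative interior of the dilate k•P is at least the binomial coefficient C(k−1, d). -/
open Pointwise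

lemma aux_relint {n : ℕ} {ι : Type} [Fintype ι] (S : Set (Fin n → ℝ)) (hS : Convex ℝ S)
    (p : ι → Fin n → ℝ) (hp : AffineIndependent ℝ p) (hpS : ∀ i, p i ∈ S)
    (hspan : affineSpan ℝ (Set.range p) = affineSpan ℝ S)
    (c : ι → ℝ) (hc : ∀ i, 0 < c i) (hc1 : ∑ i, c i = 1) :
    ∑ i, c i • p i ∈ intrinsicInterior ℝ S := by
  classical
  have hne : Nonempty ι := by
    by_contra h
    rw [not_nonempty_iff] at h
    simp at hc1
  let i0 : ι := Classical.choice hne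
  let A := affineSpan ℝ S
  have hA : ∀ i, p i ∈ A := fun i => subset_affineSpan ℝ S (hpS i)
  have : Nonempty A := ⟨⟨p i0, hA i0⟩⟩
  let q : ι → A := fun i => ⟨p i, hA i⟩
  have hq : AffineIndependent ℝ q := AffineIndependent.of_comp A.subtype hp
  have hqs : affineSpan ℝ (Set.range q) = ⊤ := by
    have hm : (affineSpan ℝ (Set.range q)).map A.subtype = A := by
      rw [AffineSubspace.map_span, ← Set.range_comp]
      exact hspan
    rw [eq_top_iff]
    intro x _
    have hx : (x : Fin n → ℝ) ∈ (affineSpan ℝ (Set.range q)).map A.subtype := by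
      rw [hm]; exact x.2
    obtain ⟨y, hy, hyx⟩ := hx
    have : y = x := Subtype.ext hyx
    exact this ▸ hy
  let b : AffineBasis ι ℝ A := ⟨q, hq, hqs⟩
  have hcont : ∀ i, Continuous (b.coord i) := fun i =>
    AffineMap.continuous_linear_iff.1 (LinearMap.continuous_of_finiteDimensional _)
  have hval : ∀ w : ι → ℝ, ∑ i, w i = 1 →
      ((Finset.univ.affineCombination ℝ q w : A) : Fin n → ℝ) = ∑ i, w i • p i := by
    intro w hw
    have h := Finset.univ.map_affineCombination q w hw A.subtype
    rw [Finset.affineCombination_eq_linear_combination _ _ _ hw] at h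
    exact h
  rw [mem_intrinsicInterior]
  refine ⟨Finset.univ.affineCombination ℝ q c, ?_, hval c hc1⟩
  rw [mem_interior]
  refine ⟨⋂ i, (b.coord i) ⁻¹' Set.Ioi 0, ?_, ?_, ?_⟩
  · intro x hx
    simp only [Set.mem_iInter, Set.mem_preimage, Set.mem_Ioi] at hx
    have h1 : ∑ i, b.coord i x = 1 := b.sum_coord_apply_eq_one x
    have h2 := hval (fun i => b.coord i x) h1
    have h3 : Finset.univ.affineCombination ℝ q (fun i => b.coord i x) = x :=
      b.affineCombination_coord_eq_self x
    rw [h3] at h2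
    rw [Set.mem_preimage, h2]
    exact hS.sum_mem (fun i _ => (hx i).le) h1 (fun i _ => hpS i)
  · exact isOpen_iInter_of_finite fun i => isOpen_Ioi.preimage (hcont i)
  · simp only [Set.mem_iInter, Set.mem_preimage, Set.mem_Ioi]
    intro i
    have := b.coord_apply_combination_of_mem (Finset.mem_univ i) hc1
    have h4 : b.coord i (Finset.univ.affineCombination ℝ q c) = c i := this
    rw [h4]; exact hc i

lemma aux_finite {n : ℕ} (S : Set (Fin n → ℝ)) (hS : Bornology.IsBounded S) :
    {x : Fin n → ℝ | x ∈ S ∧ ∀ i, ∃ m : ℤ, x i = (m : ℝ)}.Finite := by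
  obtain ⟨R, hR⟩ := hS.exists_norm_le
  have : (Set.Icc (fun _ : Fin n => (-⌈R⌉ : ℤ)) (fun _ => ⌈R⌉)).Finite := Set.finite_Icc _ _
  refine (this.image (fun (m : Fin n → ℤ) i => (m i : ℝ))).subset ?_
  rintro x ⟨hx, hm⟩
  choose m hm using hm
  have hb : ∀ i, |(m i : ℝ)| ≤ R := fun i => by
    rw [← hm i]; exact (norm_le_pi_norm x i).trans (hR x hx)
  refine ⟨m, ⟨fun i => ?_, fun i => ?_⟩, ?_⟩
  · have h1 := (abs_le.1 (hb i)).1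
    have h2 := Int.le_ceil R
    have : ((-⌈R⌉ : ℤ) : ℝ) ≤ m i := by push_cast; linarith
    exact_mod_cast this
  · have h1 := (abs_le.1 (hb i)).2
    have h2 := Int.le_ceil R
    have : (m i : ℝ) ≤ (⌈R⌉ : ℤ) := by linarith
    exact_mod_cast this
  · funext i; exact (hm i).symm

/-- Let `P ⊆ ℝ^n` be a lattice polytope whose affine hull has dimension
`d ≥ 1`. Then for every integer `k ≥ 1`, the number of integer points in the relative
interior of `k•P` is at least the binomial coefficient `C(k−1, d)`. -/
theorem stmt1 (n : ℕ) (V : Finset (Fin n → ℝ)) (hV : V.Nonempty)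
    (hVint : ∀ v ∈ V, ∀ i, ∃ m : ℤ, v i = (m : ℝ))
    (P : Set (Fin n → ℝ)) (hP : P = convexHull ℝ (V : Set (Fin n → ℝ)))
    (d : ℕ) (hd : 1 ≤ d)
    (hdim : Module.finrank ℝ (affineSpan ℝ P).direction = d)
    (k : ℕ) (hk : 1 ≤ k) :
    Nat.choose (k - 1) d ≤
      {x : Fin n → ℝ |
        x ∈ intrinsicInterior ℝ ((k : ℝ) • P) ∧ ∀ i, ∃ m : ℤ, x i = (m : ℝ)}.ncard := by
  classical
  rcases lt_or_ge (k - 1) d with hkd | hkd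
  · rw [Nat.choose_eq_zero_of_lt hkd]; exact Nat.zero_le _
  have hk0 : (k : ℝ) ≠ 0 := by positivity
  set W : Set (Fin n → ℝ) := (k : ℝ) • (V : Set (Fin n → ℝ)) with hW
  have hkP : (k : ℝ) • P = convexHull ℝ W := by rw [hP, hW, convexHull_smul]
  have hWfin : W.Finite := V.finite_toSet.smul_set
  obtain ⟨t, htW, htspan, hti⟩ := exists_affineIndependent ℝ (Fin n → ℝ) W
  have htfin : t.Finite := hWfin.subset htW
  have : Fintype t := htfin.fintype
  have hspanS : affineSpan ℝ ((k : ℝ) • P) = affineSpan ℝ t := by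
    rw [hkP, affineSpan_convexHull, htspan]
  have hWne : W.Nonempty := (Finset.coe_nonempty.2 hV).smul_set
  have htne : Nonempty t := by
    rw [Set.nonempty_coe_sort, ← affineSpan_nonempty ℝ, htspan, affineSpan_nonempty]
    exact hWne
  have hcard : Fintype.card t = d + 1 := by
    rw [← hti.finrank_vectorSpan_add_one, Subtype.range_coe, ← direction_affineSpan, ← hspanS,
      ← AffineSubspace.smul_span, AffineSubspace.direction_smul hk0, hdim]
  have hv : ∀ i : t, ∃ v ∈ V, (k : ℝ) • v = i.1 := fun i => by
    obtain ⟨v, hv, h⟩ := htW i.2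
    exact ⟨v, hv, h⟩
  choose v hvV hvt using hv
  choose z hz using fun i : t => hVint (v i) (hvV i)
  let F : (t →₀ ℕ) → (Fin n → ℝ) := fun a => ∑ i, (((a i : ℝ) + 1) / k) • (i : Fin n → ℝ)
  let T := Finset.finsuppAntidiag (Finset.univ : Finset t) (k - 1 - d)
  have hTsum : ∀ a ∈ T, ∑ i, (((a i : ℝ) + 1) / k) = 1 := by
    intro a ha
    have h : ∑ i, a i = k - 1 - d := (Finset.mem_finsuppAntidiag.1 ha).1
    rw [← Finset.sum_div, Finset.sum_add_distrib, div_eq_one_iff_eq hk0, ← Nat.cast_sum, h]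
    simp only [Finset.sum_const, Finset.card_univ, hcard, nsmul_eq_mul, mul_one]
    norm_cast
    omega
  have hTcard : T.card = Nat.choose (k - 1) d := by
    rw [Finset.card_finsuppAntidiag_nat_eq_choose, Finset.card_univ, hcard,
      ← Nat.choose_symm hkd]
    congr 1
    omega
  have hFinj : Set.InjOn F T := by
    intro a ha b hb hab
    have h := hti.eq_of_sum_eq_sum (s := Finset.univ)
      (w₁ := fun i => ((a i : ℝ) + 1) / k) (w₂ := fun i => ((b i : ℝ) + 1) / k)
      (by rw [hTsum a ha, hTsum b hb]) hab
    ext i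
    have h' := h i (Finset.mem_univ i)
    simp only [div_left_inj' hk0, add_left_inj, Nat.cast_inj] at h'
    exact h'
  rw [← hTcard, ← Set.ncard_coe_finset, ← Set.InjOn.ncard_image hFinj]
  apply Set.ncard_le_ncard
  · rintro _ ⟨a, ha, rfl⟩
    refine ⟨?_, ?_⟩
    · apply aux_relint _ _ _ hti _ _ _ _ (hTsum a ha)
      · rw [hkP]; exact convex_convexHull ℝ W
      · intro i; rw [hkP]; exact subset_convexHull ℝ W (htW i.2)
      · rw [Subtype.range_coe, hspanS]
      · intro i; positivity
    · intro j
      refine ⟨∑ i, ((a i : ℤ) + 1) * z i j, ?_⟩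
      simp only [F, Finset.sum_apply, Pi.smul_apply, smul_eq_mul]
      push_cast
      refine Finset.sum_congr rfl fun i _ => ?_
      rw [← hvt i, ← hz i j, Pi.smul_apply, smul_eq_mul]
      field_simp
  · refine (aux_finite ((k : ℝ) • P) ?_).subset fun x hx => ⟨intrinsicInterior_subset hx.1, hx.2⟩
    rw [hkP]
    exact (isBounded_convexHull).2 hWfin.isBounded
end

section
/- Let N ≥ 2 be an integer and let t₁, t₂ ≥ 0 be real numbers. Then the Minkowski sum t₁Δ(N,1) + t₂Δ(N,2) of the dilated standard simplex and the dilated second hypersimplex equals the set {x ∈ ℝ^N : x_i ≥ 0 for all i, x_1+⋯+x_N = t₁+2t₂, and x_i ≤ t₁+t₂ for all i}. -/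
open Pointwise

lemma aux_convex (N : ℕ) (c : ℝ) :
    Convex ℝ {x : Fin N → ℝ | (∀ i, 0 ≤ x i ∧ x i ≤ 1) ∧ ∑ i, x i = c} := by
  rintro x ⟨hx, hxs⟩ y ⟨hy, hys⟩ a b ha hb hab
  refine ⟨fun i => ?_, ?_⟩
  · have h1 := hx i
    have h2 := hy i
    simp only [Pi.add_apply, Pi.smul_apply, smul_eq_mul]
    constructor
    · have := mul_nonneg ha h1.1
      have := mul_nonneg hb h2.1
      linarith
    · have := mul_le_mul_of_nonneg_left h1.2 ha
      have := mul_le_mul_of_nonneg_left h2.2 hb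
      linarith
  · simp only [Pi.add_apply, Pi.smul_apply, smul_eq_mul]
    rw [Finset.sum_add_distrib, ← Finset.mul_sum, ← Finset.mul_sum, hxs, hys, ← add_mul, hab,
      one_mul]

/-- For `N ≥ 2` and reals `t₁, t₂ ≥ 0`, the Minkowski sum
`t₁Δ(N,1) + t₂Δ(N,2)` of the dilated standard simplex and the dilated second hypersimplex
equals `{x : x_i ≥ 0, ∑ x_i = t₁+2t₂, x_i ≤ t₁+t₂}`. -/
theorem stmt3 (N : ℕ) (hN : 2 ≤ N) (t₁ t₂ : ℝ) (ht₁ : 0 ≤ t₁) (ht₂ : 0 ≤ t₂) :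
    let Δ₁ : Set (Fin N → ℝ) :=
      convexHull ℝ (Set.range fun i : Fin N => (Pi.single i 1 : Fin N → ℝ))
    let Δ₂ : Set (Fin N → ℝ) :=
      convexHull ℝ {x | ∃ r s : Fin N, r < s ∧
        x = (Pi.single r 1 : Fin N → ℝ) + (Pi.single s 1 : Fin N → ℝ)}
    t₁ • Δ₁ + t₂ • Δ₂ =
      {x : Fin N → ℝ | (∀ i, 0 ≤ x i) ∧ ∑ i, x i = t₁ + 2 * t₂ ∧ ∀ i, x i ≤ t₁ + t₂} := by
  intro Δ₁ Δ₂
  have h1 : Δ₁ ⊆ {x : Fin N → ℝ | (∀ i, 0 ≤ x i ∧ x i ≤ 1) ∧ ∑ i, x i = 1} := by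
    refine convexHull_min ?_ (aux_convex N 1)
    rintro _ ⟨r, rfl⟩
    refine ⟨fun i => ?_, by simp⟩
    by_cases h : i = r <;> simp [Pi.single_apply, h]
  have h2 : Δ₂ ⊆ {x : Fin N → ℝ | (∀ i, 0 ≤ x i ∧ x i ≤ 1) ∧ ∑ i, x i = 2} := by
    refine convexHull_min ?_ (aux_convex N 2)
    rintro _ ⟨r, s, hrs, rfl⟩
    refine ⟨fun i => ?_, ?_⟩
    · by_cases h : i = r
      · subst h
        simp [Pi.single_apply, hrs.ne]
      · by_cases h' : i = s <;> simp [Pi.single_apply, h, h', hrs.ne']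
    · simp [Finset.sum_add_distrib]
      norm_num
  apply Set.Subset.antisymm
  · rintro _ ⟨_, ⟨u, hu, rfl⟩, _, ⟨v, hv, rfl⟩, rfl⟩
    obtain ⟨hu, hus⟩ := h1 hu
    obtain ⟨hv, hvs⟩ := h2 hv
    simp only [Set.mem_setOf_eq, Pi.add_apply, Pi.smul_apply, smul_eq_mul]
    refine ⟨fun i => ?_, ?_, fun i => ?_⟩
    · exact add_nonneg (mul_nonneg ht₁ (hu i).1) (mul_nonneg ht₂ (hv i).1)
    · rw [Finset.sum_add_distrib, ← Finset.mul_sum, ← Finset.mul_sum, hus, hvs]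
      ring
    · have := mul_le_mul_of_nonneg_left (hu i).2 ht₁
      have := mul_le_mul_of_nonneg_left (hv i).2 ht₂
      linarith
  · rintro x ⟨hx0, hxs, hxt⟩
    by_contra hx
    have c1 : IsCompact Δ₁ := (Set.finite_range _).isCompact_convexHull ℝ
    have c2 : IsCompact Δ₂ := by
      refine Set.Finite.isCompact_convexHull ℝ ?_
      refine (Set.finite_range (fun p : Fin N × Fin N =>
        (Pi.single p.1 1 : Fin N → ℝ) + (Pi.single p.2 1 : Fin N → ℝ))).subset ?_
      rintro _ ⟨r, s, -, rfl⟩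
      exact ⟨(r, s), rfl⟩
    have hc : Convex ℝ (t₁ • Δ₁ + t₂ • Δ₂) :=
      ((convex_convexHull ℝ _).smul _).add ((convex_convexHull ℝ _).smul _)
    obtain ⟨f, u, hf, hfx⟩ := geometric_hahn_banach_closed_point hc
      ((c1.smul t₁).add (c2.smul t₂)).isClosed hx
    set c : Fin N → ℝ := fun i => f (Pi.single i 1) with hcdef
    have hfx' : f x = ∑ i, x i * c i := by
      conv_lhs => rw [pi_eq_sum_univ' x]
      simp only [map_sum, map_smul, smul_eq_mul, hcdef]
    have : Nontrivial (Fin N) := Fin.nontrivial_iff_two_le.2 hN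
    obtain ⟨a, -, ha⟩ := Finset.exists_max_image Finset.univ c Finset.univ_nonempty
    obtain ⟨b', hb'⟩ := exists_ne a
    obtain ⟨b, hbm, hb⟩ := Finset.exists_max_image (Finset.univ.erase a) c
      ⟨b', by simp [hb']⟩
    have hba : b ≠ a := Finset.ne_of_mem_erase hbm
    have m1 : (Pi.single a 1 : Fin N → ℝ) ∈ Δ₁ := subset_convexHull ℝ _ ⟨a, rfl⟩
    have m2 : (Pi.single a 1 : Fin N → ℝ) + Pi.single b 1 ∈ Δ₂ := by
      apply subset_convexHull ℝ _
      rcases lt_or_gt_of_ne hba with h | h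
      · exact ⟨b, a, h, add_comm _ _⟩
      · exact ⟨a, b, h, rfl⟩
    have key := hf _ (Set.add_mem_add (Set.smul_mem_smul_set (a := t₁) m1)
      (Set.smul_mem_smul_set (a := t₂) m2))
    simp only [map_add, map_smul, smul_eq_mul] at key
    change t₁ * c a + t₂ * (c a + c b) < u at key
    have hs1 := Finset.add_sum_erase Finset.univ (fun i => x i * c i) (Finset.mem_univ a)
    have hs2 := Finset.add_sum_erase Finset.univ x (Finset.mem_univ a)
    have hs3 : ∑ i ∈ Finset.univ.erase a, x i * c i ≤ (∑ i ∈ Finset.univ.erase a, x i) * c b := by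
      rw [Finset.sum_mul]
      exact Finset.sum_le_sum fun i hi => mul_le_mul_of_nonneg_left (hb i hi) (hx0 i)
    have e : ∑ i ∈ Finset.univ.erase a, x i = t₁ + 2 * t₂ - x a := by linarith
    rw [e] at hs3
    have := mul_le_mul_of_nonneg_right (hxt a) (sub_nonneg.2 (ha b (Finset.mem_univ b)))
    nlinarith
end

section
/- Let N ≥ 2 be an integer and let t₁, t₂ ∈ ℕ. Then the number of points x ∈ ℤ^N with x_i ≥ 0 for all i, x_1+⋯+x_N = t₁+2t₂, and x_i ≤ t₁+t₂ for all i (equivalently, the number of lattice points of the Minkowski sum t₁Δ(N,1)+t₂Δ(N,2)) equals C(t₁+2t₂+N−1, N−1) − N·C(t₂+N−2, N−1). -/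
theorem card_all (N n : ℕ) (hN : 1 ≤ N) :
    (Finset.piAntidiag (Finset.univ : Finset (Fin N)) n).card =
      Nat.choose (n + N - 1) (N - 1) := by
  classical
  have h1 : (Finset.piAntidiag (Finset.univ : Finset (Fin N)) n).card =
      Fintype.card (Sym (Fin N) n) := by
    rw [← Nat.card_eq_fintype_card, Nat.card_congr (Sym.equivNatSumOfFintype (Fin N) n),
      ← Nat.card_eq_finsetCard]
    exact Nat.card_congr (Equiv.subtypeEquivRight (by intro x; simp))
  rw [h1, Sym.card_sym_eq_choose, Fintype.card_fin, Nat.add_comm N n]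
  apply Nat.choose_symm_of_eq_add
  omega

theorem card_big (N m k : ℕ) (i : Fin N) :
    ((Finset.piAntidiag (Finset.univ : Finset (Fin N)) (k + m)).filter (fun x => m ≤ x i)).card =
      (Finset.piAntidiag (Finset.univ : Finset (Fin N)) k).card := by
  classical
  symm
  apply Finset.card_bij (fun x _ => x + Pi.single i m)
  · intro x hx
    simp only [Finset.mem_piAntidiag, Finset.mem_univ, implies_true, and_true,
      Finset.mem_filter] at hx ⊢
    constructor
    · simp [Finset.sum_add_distrib, hx]
    · simp
  · intro x _ y _ h
    exact add_right_cancel h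
  · intro y hy
    simp only [Finset.mem_piAntidiag, Finset.mem_univ, implies_true, and_true,
      Finset.mem_filter] at hy
    have e : (y - Pi.single i m) + Pi.single i m = y := by
      funext j
      by_cases hj : j = i
      · subst hj; simp; omega
      · simp [hj]
    refine ⟨y - Pi.single i m, ?_, e⟩
    have h2 := hy.1
    rw [← e] at h2
    simp only [Finset.mem_piAntidiag, Finset.mem_univ, implies_true, and_true]
    simp only [Pi.add_apply, Finset.sum_add_distrib, Finset.sum_pi_single', Finset.mem_univ,
      if_true] at h2
    simp at h2
    simpa using h2

/-- For `N ≥ 2` and `t₁, t₂ ∈ ℕ`, the number of lattice points of the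
Minkowski sum `t₁Δ(N,1)+t₂Δ(N,2)`, i.e. the number of `x ∈ ℕ^N` with `∑ x_i = t₁+2t₂` and
`x_i ≤ t₁+t₂` for all `i`, equals `C(t₁+2t₂+N−1, N−1) − N·C(t₂+N−2, N−1)`. -/
theorem stmt4 (N t₁ t₂ : ℕ) (hN : 2 ≤ N) :
    ({x : Fin N → ℕ | ∑ i, x i = t₁ + 2 * t₂ ∧ ∀ i, x i ≤ t₁ + t₂}.ncard : ℤ) =
      (Nat.choose (t₁ + 2 * t₂ + N - 1) (N - 1) : ℤ)
        - (N : ℤ) * (Nat.choose (t₂ + N - 2) (N - 1) : ℤ) := by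
  classical
  set S := Finset.piAntidiag (Finset.univ : Finset (Fin N)) (t₁ + 2 * t₂) with hS
  have memS : ∀ x, x ∈ S ↔ ∑ i, x i = t₁ + 2 * t₂ := by
    intro x; simp [hS]
  have hset : {x : Fin N → ℕ | ∑ i, x i = t₁ + 2 * t₂ ∧ ∀ i, x i ≤ t₁ + t₂} =
      ((S.filter (fun x => ∀ i, x i ≤ t₁ + t₂) : Finset (Fin N → ℕ)) : Set (Fin N → ℕ)) := by
    ext x; simp [memS]
  rw [hset, Set.ncard_coe_finset]
  have hsplit := Finset.card_filter_add_card_filter_not (s := S) (fun x => ∀ i, x i ≤ t₁ + t₂)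
  have hbad : S.filter (fun x => ¬ ∀ i, x i ≤ t₁ + t₂) =
      (Finset.univ : Finset (Fin N)).biUnion
        (fun i => S.filter (fun x => t₁ + t₂ + 1 ≤ x i)) := by
    ext x
    simp only [Finset.mem_filter, Finset.mem_biUnion, Finset.mem_univ, true_and, not_forall,
      not_le, Nat.succ_le_iff]
    exact ⟨fun ⟨a, i, b⟩ => ⟨i, a, b⟩, fun ⟨i, a, b⟩ => ⟨a, i, b⟩⟩
  have hcard : (S.filter (fun x => ¬ ∀ i, x i ≤ t₁ + t₂)).card =
      N * Nat.choose (t₂ + N - 2) (N - 1) := by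
    rw [hbad, Finset.card_biUnion]
    · have hi : ∀ i ∈ (Finset.univ : Finset (Fin N)),
          (S.filter (fun x => t₁ + t₂ + 1 ≤ x i)).card = Nat.choose (t₂ + N - 2) (N - 1) := by
        intro i _
        rcases Nat.eq_zero_or_pos t₂ with h0 | hpos
        · rw [Nat.choose_eq_zero_of_lt (by omega), Finset.card_eq_zero,
            Finset.filter_eq_empty_iff]
          intro x hx hxi
          rw [memS] at hx
          have := Finset.single_le_sum (f := x) (fun j _ => Nat.zero_le _) (Finset.mem_univ i)
          omega
        · have h := card_big N (t₁ + t₂ + 1) (t₂ - 1) i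
          rw [card_all N _ (by omega)] at h
          have e1 : t₂ - 1 + (t₁ + t₂ + 1) = t₁ + 2 * t₂ := by omega
          have e2 : t₂ - 1 + N - 1 = t₂ + N - 2 := by omega
          rw [e1, e2] at h
          exact h
      rw [Finset.sum_congr rfl hi]
      simp
    · intro i _ j _ hij
      rw [Function.onFun, Finset.disjoint_left]
      intro x hx hx'
      simp only [Finset.mem_filter, memS] at hx hx'
      have h3 : x i + x j ≤ ∑ k, x k := by
        rw [← Finset.sum_pair hij]
        exact Finset.sum_le_sum_of_subset (Finset.subset_univ _)
      omega
  rw [hcard, card_all N _ (by omega)] at hsplit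
  rw [← hsplit]
  push_cast
  ring
end

section
/- Let N ≥ 3 be an integer and let t₁, t₂ ∈ ℕ, not both zero. Then the set of points of ℤ^N in the relative interior of the Minkowski sum t₁Δ(N,1) + t₂Δ(N,2) is exactly {x ∈ ℤ^N : x_1+⋯+x_N = t₁+2t₂ and 1 ≤ x_i ≤ t₁+t₂−1 for all i}, and its cardinality equals C(t₁+2t₂−1, N−1) − N·C(t₂, N−1) (as an identity of integers). -/
open Pointwise

def posSum (N K : ℕ) : Finset (Fin N → ℕ) :=
  (Fintype.piFinset fun _ : Fin N => Finset.Icc 1 K).filter (fun x => ∑ i, x i = K)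

lemma mem_posSum {N K : ℕ} {x : Fin N → ℕ} :
    x ∈ posSum N K ↔ (∀ i, 1 ≤ x i) ∧ ∑ i, x i = K := by
  simp only [posSum, Finset.mem_filter, Fintype.mem_piFinset, Finset.mem_Icc]
  constructor
  · rintro ⟨h, h2⟩
    exact ⟨fun i => (h i).1, h2⟩
  · rintro ⟨h, h2⟩
    refine ⟨fun i => ⟨h i, ?_⟩, h2⟩
    rw [← h2]
    exact Finset.single_le_sum (f := x) (fun _ _ => Nat.zero_le _) (Finset.mem_univ i)

lemma card_sum_eq (N M : ℕ) :
    Nat.card {x : Fin N → ℕ // ∑ i, x i = M} = Nat.multichoose N M := by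
  rw [← Nat.card_congr (Sym.equivNatSumOfFintype (Fin N) M), Nat.card_eq_fintype_card,
    Sym.card_sym_eq_multichoose, Fintype.card_fin]

lemma card_posSum (N K : ℕ) (hN : 1 ≤ N) :
    (posSum N (K + 1)).card = Nat.choose K (N - 1) := by
  by_cases h : N ≤ K + 1
  · obtain ⟨M, hM⟩ := Nat.exists_eq_add_of_le h
    have e : {x : Fin N → ℕ // ∑ i, x i = M} ≃ posSum N (K + 1) :=
      { toFun := fun x => ⟨fun i => x.1 i + 1, by
          rw [mem_posSum]
          refine ⟨fun i => by simp, ?_⟩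
          simp [Finset.sum_add_distrib, x.2]; omega⟩
        invFun := fun x => ⟨fun i => x.1 i - 1, by
          obtain ⟨h1, h2⟩ := mem_posSum.1 x.2
          have : ∑ i, x.1 i = ∑ i, (x.1 i - 1) + N := by
            have : ∑ i, x.1 i = ∑ i, ((x.1 i - 1) + 1) :=
              Finset.sum_congr rfl fun i _ => by have := h1 i; omega
            rw [this, Finset.sum_add_distrib]; simp
          show ∑ i, (x.1 i - 1) = M
          omega⟩
        left_inv := fun x => by ext i; simp
        right_inv := fun x => by
          ext i
          have := (mem_posSum.1 x.2).1 i
          simp only []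
          omega }
    have h3 := Nat.card_congr e
    rw [card_sum_eq, Nat.card_eq_fintype_card, Fintype.card_coe, Nat.multichoose_eq] at h3
    rw [← h3]
    have : N + M - 1 = K := by omega
    rw [this]
    apply Nat.choose_symm_of_eq_add
    omega
  · rw [Nat.choose_eq_zero_of_lt (by omega), Finset.card_eq_zero, Finset.eq_empty_iff_forall_notMem]
    intro x hx
    obtain ⟨h1, h2⟩ := mem_posSum.1 hx
    have : ∑ i : Fin N, 1 ≤ ∑ i, x i := Finset.sum_le_sum fun i _ => h1 i
    simp at this
    omega

lemma card_bad (N t₁ t₂ : ℕ) (hN : 3 ≤ N) (ht : 1 ≤ t₁ + t₂) (j : Fin N) :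
    ((posSum N (t₁ + 2 * t₂)).filter (fun x => t₁ + t₂ ≤ x j)).card = Nat.choose t₂ (N - 1) := by
  rw [← card_posSum N t₂ (by omega)]
  have key : ∀ (x : Fin N → ℕ) (a : ℕ), ∑ i, Function.update x j a i + x j = ∑ i, x i + a := by
    intro x a
    rw [Finset.sum_update_of_mem (Finset.mem_univ j),
      ← Finset.add_sum_erase Finset.univ x (Finset.mem_univ j), Finset.sdiff_singleton_eq_erase]
    omega
  apply Finset.card_nbij' (fun x => Function.update x j (x j - (t₁ + t₂ - 1)))
    (fun x => Function.update x j (x j + (t₁ + t₂ - 1)))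
  · intro x hx
    simp only [Finset.coe_filter, Set.mem_ofPred_eq, mem_posSum] at hx
    obtain ⟨⟨h1, h2⟩, h3⟩ := hx
    simp only [Finset.mem_coe, mem_posSum]
    constructor
    · intro i
      by_cases hi : i = j
      · subst hi; simp; omega
      · simp [hi, h1 i]
    · have := key x (x j - (t₁ + t₂ - 1))
      omega
  · intro x hx
    simp only [Finset.mem_coe, mem_posSum] at hx
    obtain ⟨h1, h2⟩ := hx
    simp only [Finset.coe_filter, Set.mem_ofPred_eq, mem_posSum]
    have h4 := h1 j
    refine ⟨⟨?_, ?_⟩, ?_⟩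
    · intro i
      by_cases hi : i = j
      · subst hi; simp; omega
      · simp [hi, h1 i]
    · have := key x (x j + (t₁ + t₂ - 1))
      omega
    · simp; omega
  · intro x hx
    simp only [Finset.coe_filter, Set.mem_ofPred_eq, mem_posSum] at hx
    obtain ⟨⟨h1, h2⟩, h3⟩ := hx
    simp only [Function.update_self, Function.update_idem]
    rw [Nat.sub_add_cancel (by omega), Function.update_eq_self]
  · intro x hx
    simp

lemma card_good (N t₁ t₂ : ℕ) (hN : 3 ≤ N) (ht : 1 ≤ t₁ + t₂) :
    (((posSum N (t₁ + 2 * t₂)).filter (fun x => ∀ i, x i < t₁ + t₂)).card : ℤ)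
      = (Nat.choose (t₁ + 2 * t₂ - 1) (N - 1) : ℤ) - (N : ℤ) * (Nat.choose t₂ (N - 1) : ℤ) := by
  classical
  have h1 := Finset.card_filter_add_card_filter_not (s := posSum N (t₁ + 2 * t₂))
    (fun x => ∀ i, x i < t₁ + t₂)
  have h2 : (posSum N (t₁ + 2 * t₂)).filter (fun x => ¬ ∀ i, x i < t₁ + t₂)
      = Finset.univ.biUnion fun j =>
        (posSum N (t₁ + 2 * t₂)).filter (fun x => t₁ + t₂ ≤ x j) := by
    ext x
    simp
  have h3 : (Finset.univ.biUnion fun j =>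
        (posSum N (t₁ + 2 * t₂)).filter (fun x => t₁ + t₂ ≤ x j)).card
        = N * Nat.choose t₂ (N - 1) := by
    rw [Finset.card_biUnion]
    · simp [card_bad N t₁ t₂ hN ht]
    · intro i _ j _ hij
      rw [Function.onFun, Finset.disjoint_left]
      intro x hx hx'
      simp only [Finset.mem_filter, mem_posSum] at hx hx'
      obtain ⟨⟨p1, p2⟩, p3⟩ := hx
      obtain ⟨k, hk⟩ : ∃ k : Fin N, k ∉ ({i, j} : Finset (Fin N)) := by
        by_contra hcon
        push Not at hcon
        have := Finset.card_le_card (fun k _ => hcon k : (Finset.univ : Finset (Fin N)) ⊆ {i, j})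
        have h2 := Finset.card_le_two (a := i) (b := j)
        simp only [Finset.card_univ, Fintype.card_fin] at this
        omega
      have h5 : ∑ l ∈ insert k {i, j}, x l ≤ ∑ l, x l :=
        Finset.sum_le_sum_of_subset (Finset.subset_univ _)
      rw [Finset.sum_insert hk, Finset.sum_pair hij] at h5
      have := p1 k
      have := hx'.2
      omega
  have h4 : (posSum N (t₁ + 2 * t₂)).card = Nat.choose (t₁ + 2 * t₂ - 1) (N - 1) := by
    rw [← card_posSum N _ (by omega), Nat.sub_add_cancel (by omega)]
  rw [h2, h3, h4] at h1
  have h5 := congrArg (Nat.cast : ℕ → ℤ) h1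
  push_cast at h5
  linarith

lemma poly_eq (N t₁ t₂ : ℕ) (hN : 3 ≤ N) :
    (t₁ : ℝ) • convexHull ℝ (Set.range fun i : Fin N => (Pi.single i 1 : Fin N → ℝ))
     + (t₂ : ℝ) • convexHull ℝ {x | ∃ r s : Fin N, r < s ∧
        x = (Pi.single r 1 : Fin N → ℝ) + (Pi.single s 1 : Fin N → ℝ)}
    = {x | (∀ i, 0 ≤ x i ∧ x i ≤ (t₁ : ℝ) + t₂) ∧ ∑ i, x i = (t₁ : ℝ) + 2 * t₂} := by
  have hadj : ∀ r s : Fin N, r ≠ s → (Pi.single r 1 : Fin N → ℝ) + (Pi.single s 1 : Fin N → ℝ) ∈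
      {x | ∃ r s : Fin N, r < s ∧
        x = (Pi.single r 1 : Fin N → ℝ) + (Pi.single s 1 : Fin N → ℝ)} := by
    intro r s hrs
    rcases lt_or_gt_of_ne hrs with h | h
    · exact ⟨r, s, h, rfl⟩
    · exact ⟨s, r, h, add_comm _ _⟩
  apply Set.Subset.antisymm
  · have hconv : ∀ a b : ℝ, Convex ℝ {x : Fin N → ℝ | (∀ i, 0 ≤ x i ∧ x i ≤ a) ∧ ∑ i, x i = b} := by
      intro a b x hx y hy p q hp hq hpq
      refine ⟨fun i => ?_, ?_⟩
      · obtain ⟨h1, h2⟩ := hx.1 i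
        obtain ⟨h3, h4⟩ := hy.1 i
        simp only [Pi.add_apply, Pi.smul_apply, smul_eq_mul]
        refine ⟨by positivity, ?_⟩
        calc p * x i + q * y i ≤ p * a + q * a := by gcongr
          _ = a := by rw [← add_mul, hpq, one_mul]
      · simp only [Pi.add_apply, Pi.smul_apply, smul_eq_mul, Finset.sum_add_distrib,
          ← Finset.mul_sum]
        rw [hx.2, hy.2, ← add_mul, hpq, one_mul]
    have hA : convexHull ℝ (Set.range fun i : Fin N => (Pi.single i 1 : Fin N → ℝ)) ⊆
        {x : Fin N → ℝ | (∀ i, 0 ≤ x i ∧ x i ≤ 1) ∧ ∑ i, x i = 1} := by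
      apply convexHull_min _ (hconv _ _)
      rintro _ ⟨i, rfl⟩
      refine ⟨fun k => ?_, by simp⟩
      by_cases h : k = i
      · subst h; simp
      · simp [h]
    have hB : convexHull ℝ {x | ∃ r s : Fin N, r < s ∧
        x = (Pi.single r 1 : Fin N → ℝ) + (Pi.single s 1 : Fin N → ℝ)} ⊆
        {x : Fin N → ℝ | (∀ i, 0 ≤ x i ∧ x i ≤ 1) ∧ ∑ i, x i = 2} := by
      apply convexHull_min _ (hconv _ _)
      rintro _ ⟨r, s, hrs, rfl⟩
      refine ⟨fun k => ?_, by simp [Finset.sum_add_distrib]; norm_num⟩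
      by_cases h : k = r
      · subst h; simp [hrs.ne]
      · by_cases h' : k = s
        · subst h'; simp [h]
        · simp [h, h']
    rintro _ ⟨_, ⟨a, ha, rfl⟩, _, ⟨b, hb, rfl⟩, rfl⟩
    obtain ⟨ha1, ha2⟩ := hA ha
    obtain ⟨hb1, hb2⟩ := hB hb
    refine ⟨fun i => ?_, ?_⟩
    · have := ha1 i
      have := hb1 i
      have h1 : (0:ℝ) ≤ t₁ := by positivity
      have h2 : (0:ℝ) ≤ t₂ := by positivity
      simp only [Pi.add_apply, Pi.smul_apply, smul_eq_mul]
      constructor <;> nlinarith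
    · simp only [Pi.add_apply, Pi.smul_apply, smul_eq_mul, Finset.sum_add_distrib,
          ← Finset.mul_sum, ha2, hb2]
      ring
  · rintro x ⟨hx1, hx2⟩
    by_contra hx
    have hc1 : Convex ℝ ((t₁ : ℝ) • convexHull ℝ (Set.range fun i : Fin N => (Pi.single i 1 : Fin N → ℝ))
     + (t₂ : ℝ) • convexHull ℝ {x | ∃ r s : Fin N, r < s ∧
        x = (Pi.single r 1 : Fin N → ℝ) + (Pi.single s 1 : Fin N → ℝ)}) :=
      ((convex_convexHull ℝ _).smul _).add ((convex_convexHull ℝ _).smul _)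
    have hfin : {x | ∃ r s : Fin N, r < s ∧
        x = (Pi.single r 1 : Fin N → ℝ) + (Pi.single s 1 : Fin N → ℝ)}.Finite := by
      apply (Set.finite_range (fun p : Fin N × Fin N =>
        (Pi.single p.1 1 : Fin N → ℝ) + (Pi.single p.2 1 : Fin N → ℝ))).subset
      rintro _ ⟨r, s, _, rfl⟩
      exact ⟨(r, s), rfl⟩
    have hc2 := ((((Set.finite_range fun i : Fin N => (Pi.single i 1 : Fin N → ℝ)).isCompact_convexHull
      ℝ).smul (t₁ : ℝ)).add ((hfin.isCompact_convexHull ℝ).smul (t₂ : ℝ))).isClosed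
    obtain ⟨f, u, hf1, hf2⟩ := geometric_hahn_banach_closed_point hc1 hc2 hx
    set c : Fin N → ℝ := fun i => f (Pi.single i 1) with hc
    have hfx : f x = ∑ i, c i * x i := by
      conv_lhs => rw [pi_eq_sum_univ' x]
      rw [map_sum]
      refine Finset.sum_congr rfl fun i _ => ?_
      rw [map_smul, smul_eq_mul, mul_comm]
    have : NeZero N := ⟨by omega⟩
    obtain ⟨r, -, hr⟩ := Finset.exists_max_image Finset.univ c Finset.univ_nonempty
    have hne : (Finset.univ.erase r : Finset (Fin N)).Nonempty := by
      rw [← Finset.card_pos, Finset.card_erase_of_mem (Finset.mem_univ r)]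
      simp; omega
    obtain ⟨s, hs, hs'⟩ := Finset.exists_max_image _ c hne
    have hsr : s ≠ r := Finset.ne_of_mem_erase hs
    have hp := hf1 ((t₁ : ℝ) • Pi.single r 1 + (t₂ : ℝ) • (Pi.single r 1 + Pi.single s 1))
      (Set.add_mem_add (Set.smul_mem_smul_set (subset_convexHull ℝ _ ⟨r, rfl⟩))
        (Set.smul_mem_smul_set (subset_convexHull ℝ _ (hadj r s hsr.symm))))
    have hp' : (t₁ : ℝ) * c r + t₂ * (c r + c s) < u := by
      simpa [hc, mul_add] using hp
    have h1 : ∑ i ∈ Finset.univ.erase r, c i * x i ≤ ∑ i ∈ Finset.univ.erase r, c s * x i :=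
      Finset.sum_le_sum fun i hi => mul_le_mul_of_nonneg_right (hs' i hi) (hx1 i).1
    rw [← Finset.mul_sum] at h1
    have h2 := Finset.add_sum_erase Finset.univ x (Finset.mem_univ r)
    have h3 := Finset.add_sum_erase Finset.univ (fun i => c i * x i) (Finset.mem_univ r)
    have h4 : ∑ i ∈ Finset.univ.erase r, x i = t₁ + 2 * t₂ - x r := by linarith
    rw [h4] at h1
    have h5 := hr s (Finset.mem_univ _)
    have h6 := (hx1 r).2
    nlinarith [mul_nonneg (sub_nonneg.2 h5) (sub_nonneg.2 h6)]

lemma int_eq (N : ℕ) (T K : ℝ) (hN : 0 < N) (hK : 0 < K) (hT : K < N * T) :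
    intrinsicInterior ℝ {x : Fin N → ℝ | (∀ i, 0 ≤ x i ∧ x i ≤ T) ∧ ∑ i, x i = K}
    = {x : Fin N → ℝ | (∀ i, 0 < x i ∧ x i < T) ∧ ∑ i, x i = K} := by
  set P := {x : Fin N → ℝ | (∀ i, 0 ≤ x i ∧ x i ≤ T) ∧ ∑ i, x i = K} with hP
  have hN' : (0:ℝ) < N := by exact_mod_cast hN
  have hspan : ∀ y ∈ affineSpan ℝ P, ∑ i, y i = K := by
    intro y hy
    refine affineSpan_induction (p := fun y : Fin N → ℝ => ∑ i, y i = K) hy ?_ ?_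
    · intro x hx
      exact hx.2
    · intro c u v w hu hv hw
      simp only [vsub_eq_sub, vadd_eq_add, Pi.add_apply, Pi.smul_apply, Pi.sub_apply, smul_eq_mul,
        Finset.sum_add_distrib, ← Finset.mul_sum, Finset.sum_sub_distrib, hu, hv, hw]
      ring
  ext x
  rw [mem_intrinsicInterior]
  constructor
  · rintro ⟨⟨x, hxs⟩, hx, rfl⟩
    have hxP : x ∈ P := by
      have := interior_subset hx
      exact this
    set y : Fin N → ℝ := fun _ => K / N with hy
    have hy0 : 0 < K / N := by positivity
    have hyT : K / N < T := by rw [div_lt_iff₀ hN']; linarith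
    have hyP : y ∈ P := by
      refine ⟨fun i => ⟨hy0.le, hyT.le⟩, ?_⟩
      simp [hy]; field_simp
    have hys := subset_affineSpan ℝ P hyP
    let g : ℝ → affineSpan ℝ P := fun t =>
      ⟨AffineMap.lineMap x y t, AffineMap.lineMap_mem t hxs hys⟩
    have hg : Continuous g := Continuous.subtype_mk AffineMap.lineMap_continuous _
    have hg0 : g 0 = ⟨x, hxs⟩ := by simp [g]
    have hev : ∀ᶠ t in nhds (0:ℝ), g t ∈ interior ((↑) ⁻¹' P : Set (affineSpan ℝ P)) :=
      hg.continuousAt.eventually_mem (by rw [hg0]; exact isOpen_interior.mem_nhds hx)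
    obtain ⟨t, ht, ht0⟩ := ((hev.filter_mono nhdsWithin_le_nhds).and
      (self_mem_nhdsWithin : Set.Iio (0:ℝ) ∈ nhdsWithin 0 (Set.Iio 0))).exists
    have htP : AffineMap.lineMap x y t ∈ P := by
      have := interior_subset ht
      exact this
    have ht0 : t < 0 := ht0
    refine ⟨fun i => ?_, hxP.2⟩
    have h1 := htP.1 i
    have h2 := hxP.1 i
    simp only [AffineMap.lineMap_apply, vsub_eq_sub, vadd_eq_add, Pi.add_apply, Pi.smul_apply,
      Pi.sub_apply, smul_eq_mul, hy] at h1
    constructor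
    · rcases h2.1.lt_or_eq with h | h
      · exact h
      · rw [← h] at h1; nlinarith
    · rcases h2.2.lt_or_eq with h | h
      · exact h
      · rw [h] at h1; nlinarith
  · rintro ⟨hx1, hx2⟩
    have hxP : x ∈ P := ⟨fun i => ⟨(hx1 i).1.le, (hx1 i).2.le⟩, hx2⟩
    refine ⟨⟨x, subset_affineSpan ℝ P hxP⟩, ?_, rfl⟩
    rw [mem_interior]
    refine ⟨(↑) ⁻¹' (Set.univ.pi fun _ : Fin N => Set.Ioo 0 T), ?_, ?_, ?_⟩
    · rintro ⟨z, hz⟩ hz'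
      simp only [Set.mem_preimage, Set.mem_univ_pi, Set.mem_Ioo] at hz'
      exact ⟨fun i => ⟨(hz' i).1.le, (hz' i).2.le⟩, hspan z hz⟩
    · exact (isOpen_set_pi Set.finite_univ fun _ _ => isOpen_Ioo).preimage continuous_subtype_val
    · simpa using hx1

/-- For `N ≥ 3` and `t₁, t₂ ∈ ℕ` not both zero, the integer points in the
relative interior of `t₁Δ(N,1) + t₂Δ(N,2)` are exactly the integer vectors with
`∑ x_i = t₁+2t₂` and `1 ≤ x_i ≤ t₁+t₂−1`, and their number equals
`C(t₁+2t₂−1, N−1) − N·C(t₂, N−1)` as integers. -/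
theorem stmt5 (N t₁ t₂ : ℕ) (hN : 3 ≤ N) (ht : ¬(t₁ = 0 ∧ t₂ = 0)) :
    let Δ₁ : Set (Fin N → ℝ) :=
      convexHull ℝ (Set.range fun i : Fin N => (Pi.single i 1 : Fin N → ℝ))
    let Δ₂ : Set (Fin N → ℝ) :=
      convexHull ℝ {x | ∃ r s : Fin N, r < s ∧
        x = (Pi.single r 1 : Fin N → ℝ) + (Pi.single s 1 : Fin N → ℝ)}
    let S : Set (Fin N → ℝ) :=
      {x | x ∈ intrinsicInterior ℝ ((t₁ : ℝ) • Δ₁ + (t₂ : ℝ) • Δ₂) ∧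
        ∀ i, ∃ m : ℤ, x i = (m : ℝ)}
    S = {x : Fin N → ℝ | (∀ i, ∃ m : ℤ, x i = (m : ℝ)) ∧
          ∑ i, x i = (t₁ : ℝ) + 2 * t₂ ∧
          ∀ i, 1 ≤ x i ∧ x i ≤ (t₁ : ℝ) + t₂ - 1} ∧
    (S.ncard : ℤ) = (Nat.choose (t₁ + 2 * t₂ - 1) (N - 1) : ℤ)
        - (N : ℤ) * (Nat.choose t₂ (N - 1) : ℤ) := by
  intro Δ₁ Δ₂ S
  have ht1 : 1 ≤ t₁ + t₂ := by omega
  have ht1' : (1:ℝ) ≤ t₁ + t₂ := by exact_mod_cast ht1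
  have h01 : (0:ℝ) ≤ t₁ := by positivity
  have h02 : (0:ℝ) ≤ t₂ := by positivity
  have hN' : (3:ℝ) ≤ N := by exact_mod_cast hN
  have hS : S = {x : Fin N → ℝ | (∀ i, ∃ m : ℤ, x i = (m : ℝ)) ∧
          ∑ i, x i = (t₁ : ℝ) + 2 * t₂ ∧
          ∀ i, 1 ≤ x i ∧ x i ≤ (t₁ : ℝ) + t₂ - 1} := by
    ext x
    simp only [S, Δ₁, Δ₂]
    rw [poly_eq N t₁ t₂ hN, int_eq N _ _ (by omega) (by linarith) (by nlinarith)]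
    simp only [Set.mem_ofPred_eq]
    constructor
    · rintro ⟨⟨h1, h2⟩, h3⟩
      refine ⟨h3, h2, fun i => ?_⟩
      obtain ⟨m, hm⟩ := h3 i
      obtain ⟨h4, h5⟩ := h1 i
      rw [hm] at h4 h5 ⊢
      have h4' : 0 < m := by exact_mod_cast h4
      have h5' : m < (t₁ + t₂ : ℤ) := by exact_mod_cast h5
      have h6 : 1 ≤ m := h4'
      have h7 : m ≤ (t₁ + t₂ : ℤ) - 1 := by omega
      exact ⟨by exact_mod_cast h6, by exact_mod_cast h7⟩
    · rintro ⟨h3, h2, h1⟩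
      exact ⟨⟨fun i => ⟨by linarith [(h1 i).1], by linarith [(h1 i).2]⟩, h2⟩, h3⟩
  refine ⟨hS, ?_⟩
  rw [← card_good N t₁ t₂ hN ht1, hS]
  have himg : {x : Fin N → ℝ | (∀ i, ∃ m : ℤ, x i = (m : ℝ)) ∧
          ∑ i, x i = (t₁ : ℝ) + 2 * t₂ ∧
          ∀ i, 1 ≤ x i ∧ x i ≤ (t₁ : ℝ) + t₂ - 1} =
      (fun (x : Fin N → ℕ) (i : Fin N) => (x i : ℝ)) ''
        ((posSum N (t₁ + 2 * t₂)).filter (fun x => ∀ i, x i < t₁ + t₂) : Finset (Fin N → ℕ)) := by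
    ext x
    simp only [Set.mem_ofPred_eq, Set.mem_image, Finset.mem_coe, Finset.mem_filter, mem_posSum]
    constructor
    · rintro ⟨h1, h2, h3⟩
      choose m hm using h1
      have hm0 : ∀ i, 1 ≤ m i := fun i => by
        have := (h3 i).1
        rw [hm i] at this
        exact_mod_cast this
      have hx : ∀ i, (((m i).toNat : ℕ) : ℝ) = x i := fun i => by
        rw [hm i]
        have : (((m i).toNat : ℕ) : ℤ) = m i := Int.toNat_of_nonneg (by linarith [hm0 i])
        exact_mod_cast congrArg (Int.cast : ℤ → ℝ) this
      refine ⟨fun i => (m i).toNat, ⟨⟨fun i => by have := hm0 i; show 1 ≤ (m i).toNat; omega, ?_⟩, fun i => ?_⟩, funext hx⟩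
      · have : ∑ i, (((m i).toNat : ℕ) : ℝ) = (t₁ : ℝ) + 2 * t₂ := by
          rw [← h2]; exact Finset.sum_congr rfl fun i _ => hx i
        exact_mod_cast this
      · have : (((m i).toNat : ℕ) : ℝ) < (t₁ : ℝ) + t₂ := by
          rw [hx i]; linarith [(h3 i).2]
        exact_mod_cast this
    · rintro ⟨y, ⟨⟨h1, h2⟩, h3⟩, rfl⟩
      refine ⟨fun i => ⟨y i, by simp⟩, ?_, fun i => ⟨?_, ?_⟩⟩
      · show ∑ i, (y i : ℝ) = _
        exact_mod_cast h2
      · show (1 : ℝ) ≤ (y i : ℝ)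
        exact_mod_cast h1 i
      have : y i + 1 ≤ t₁ + t₂ := h3 i
      have : (y i : ℝ) + 1 ≤ t₁ + t₂ := by exact_mod_cast this
      linarith
  rw [himg, Set.ncard_image_of_injective, Set.ncard_coe_finset]
  intro a b hab
  funext i
  have : (a i : ℝ) = (b i : ℝ) := congrFun hab i
  exact_mod_cast this
end

section
/- Let N ≥ 4 be an integer and let n_U, n_F ∈ ℕ, not both zero. Then the Minkowski sum n_UΔ(N,1) + n_FΔ(N,2) contains exactly one point of ℤ^N in its relative interior if and only if n_U + 2n_F = N; in that case the unique such point is (1,…,1). -/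
open Pointwise

theorem aux_ext {E : Type*} [NormedAddCommGroup E] [NormedSpace ℝ E] {s : Set E} {x c : E}
    (hx : x ∈ intrinsicInterior ℝ s) (hc : c ∈ s) :
    ∃ ε : ℝ, 0 < ε ∧ x + ε • (x - c) ∈ s := by
  rw [mem_intrinsicInterior] at hx
  obtain ⟨y, hy, rfl⟩ := hx
  have hc' : c ∈ affineSpan ℝ s := subset_affineSpan ℝ s hc
  have hmem : ∀ t : ℝ, (y : E) + t • ((y : E) - c) ∈ affineSpan ℝ s := by
    intro t
    have := AffineMap.lineMap_mem (-t) y.2 hc'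
    rw [AffineMap.lineMap_apply_module'] at this
    convert this using 1
    module
  let g : ℝ → affineSpan ℝ s := fun t => ⟨(y : E) + t • ((y : E) - c), hmem t⟩
  have hg : Continuous g := by
    apply Continuous.subtype_mk
    fun_prop
  have hg0 : g 0 = y := by
    apply Subtype.ext
    simp [g]
  have hn : ∀ᶠ t in nhds (0 : ℝ), g t ∈ interior (((↑) : affineSpan ℝ s → E) ⁻¹' s) := by
    apply hg.continuousAt.eventually_mem
    rw [hg0]
    exact isOpen_interior.mem_nhds hy
  obtain ⟨δ, hδ, h⟩ := Metric.eventually_nhds_iff.1 hn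
  refine ⟨δ / 2, by positivity, ?_⟩
  have h2 := interior_subset (h (y := δ / 2) (by
    rw [Real.dist_eq, sub_zero, abs_of_pos (by positivity)]; linarith))
  exact h2

theorem aux_poly (N nU nF : ℕ) (hN : 4 ≤ N) :
    ((nU : ℝ) • convexHull ℝ (Set.range fun i : Fin N => (Pi.single i 1 : Fin N → ℝ)) +
      (nF : ℝ) • convexHull ℝ {x | ∃ r s : Fin N, r < s ∧
        x = (Pi.single r 1 : Fin N → ℝ) + (Pi.single s 1 : Fin N → ℝ)}) =
    {x : Fin N → ℝ | (∑ i, x i = nU + 2 * nF) ∧ ∀ i, 0 ≤ x i ∧ x i ≤ nU + nF} := by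
  have : NeZero N := ⟨by omega⟩
  apply Set.Subset.antisymm
  · rintro _ ⟨_, ⟨a, ha, rfl⟩, _, ⟨b, hb, rfl⟩, rfl⟩
    have h1 : a ∈ {x : Fin N → ℝ | (∑ i, x i = 1) ∧ ∀ i, 0 ≤ x i ∧ x i ≤ 1} := by
      refine convexHull_min ?_ ?_ ha
      · rintro _ ⟨i, rfl⟩
        refine ⟨by simp, fun j => ?_⟩
        by_cases h : j = i
        · subst h; simp
        · simp [Pi.single_apply, h]
      · rintro x ⟨hx, hx'⟩ y ⟨hy, hy'⟩ p q hp hq hpq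
        refine ⟨?_, fun j => ?_⟩
        · simp [Finset.sum_add_distrib, ← Finset.mul_sum, hx, hy, hpq]
        · have := hx' j
          have := hy' j
          simp only [Pi.add_apply, Pi.smul_apply, smul_eq_mul]
          constructor
          · have := mul_nonneg hp (hx' j).1
            have := mul_nonneg hq (hy' j).1
            linarith
          · have := mul_le_mul_of_nonneg_left (hx' j).2 hp
            have := mul_le_mul_of_nonneg_left (hy' j).2 hq
            linarith
    have h2 : b ∈ {x : Fin N → ℝ | (∑ i, x i = 2) ∧ ∀ i, 0 ≤ x i ∧ x i ≤ 1} := by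
      refine convexHull_min ?_ ?_ hb
      · rintro _ ⟨r, s, hrs, rfl⟩
        refine ⟨?_, fun j => ?_⟩
        · simp [Finset.sum_add_distrib]; norm_num
        · have hne := hrs.ne
          simp only [Pi.add_apply, Pi.single_apply]
          split_ifs with h h'
          · exact absurd (h.symm.trans h') hne
          all_goals norm_num
      · rintro x ⟨hx, hx'⟩ y ⟨hy, hy'⟩ p q hp hq hpq
        refine ⟨?_, fun j => ?_⟩
        · simp [Finset.sum_add_distrib, ← Finset.mul_sum, hx, hy]
          linarith
        · simp only [Pi.add_apply, Pi.smul_apply, smul_eq_mul]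
          constructor
          · have := mul_nonneg hp (hx' j).1
            have := mul_nonneg hq (hy' j).1
            linarith
          · have := mul_le_mul_of_nonneg_left (hx' j).2 hp
            have := mul_le_mul_of_nonneg_left (hy' j).2 hq
            linarith
    obtain ⟨h1, h1'⟩ := h1
    obtain ⟨h2, h2'⟩ := h2
    have hU : (0 : ℝ) ≤ nU := Nat.cast_nonneg _
    have hF : (0 : ℝ) ≤ nF := Nat.cast_nonneg _
    refine ⟨?_, fun j => ?_⟩
    · simp [Finset.sum_add_distrib, ← Finset.mul_sum, h1, h2]
      ring
    · simp only [Pi.add_apply, Pi.smul_apply, smul_eq_mul]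
      constructor
      · have := mul_nonneg hU (h1' j).1
        have := mul_nonneg hF (h2' j).1
        linarith
      · have := mul_le_mul_of_nonneg_left (h1' j).2 hU
        have := mul_le_mul_of_nonneg_left (h2' j).2 hF
        linarith
  · rintro x ⟨hx, hx'⟩
    by_contra hcon
    have hfin1 : (Set.range fun i : Fin N => (Pi.single i 1 : Fin N → ℝ)).Finite :=
      Set.finite_range _
    have hfin2 : {x | ∃ r s : Fin N, r < s ∧
        x = (Pi.single r 1 : Fin N → ℝ) + (Pi.single s 1 : Fin N → ℝ)}.Finite := by
      refine (Set.finite_range fun p : Fin N × Fin N =>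
        (Pi.single p.1 1 : Fin N → ℝ) + (Pi.single p.2 1 : Fin N → ℝ)).subset ?_
      rintro _ ⟨r, s, _, rfl⟩
      exact ⟨(r, s), rfl⟩
    have hcl := ((hfin1.isCompact_convexHull (𝕜 := ℝ)).smul (nU : ℝ)).add ((hfin2.isCompact_convexHull (𝕜 := ℝ)).smul (nF : ℝ))
    have hcv := ((convex_convexHull ℝ (Set.range fun i : Fin N => (Pi.single i 1 : Fin N → ℝ))).smul
      (nU : ℝ)).add ((convex_convexHull ℝ {x | ∃ r s : Fin N, r < s ∧
        x = (Pi.single r 1 : Fin N → ℝ) + (Pi.single s 1 : Fin N → ℝ)}).smul (nF : ℝ))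
    obtain ⟨f, u, hf1, hf2⟩ := geometric_hahn_banach_closed_point hcv hcl.isClosed hcon
    let c : Fin N → ℝ := fun i => f (Pi.single i 1)
    have hfx : f x = ∑ i, x i * c i := by
      conv_lhs => rw [pi_eq_sum_univ' x]
      simp [c, map_sum]
    obtain ⟨i, -, hi⟩ := Finset.exists_max_image Finset.univ c ⟨0, Finset.mem_univ _⟩
    have hne : (Finset.univ.erase i).Nonempty := by
      rw [← Finset.card_pos, Finset.card_erase_of_mem (Finset.mem_univ _)]
      simp; omega
    obtain ⟨j, hj, hj'⟩ := Finset.exists_max_image (Finset.univ.erase i) c hne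
    have hji : j ≠ i := Finset.ne_of_mem_erase hj
    have hv := hf1 ((nU : ℝ) • (Pi.single i 1 : Fin N → ℝ) + (nF : ℝ) •
      ((Pi.single i 1 : Fin N → ℝ) + (Pi.single j 1 : Fin N → ℝ))) (by
        refine Set.add_mem_add (Set.smul_mem_smul_set (subset_convexHull ℝ _ ⟨i, rfl⟩))
          (Set.smul_mem_smul_set (subset_convexHull ℝ _ ?_))
        rcases lt_or_gt_of_ne hji with h | h
        · exact ⟨j, i, h, add_comm _ _⟩
        · exact ⟨i, j, h, rfl⟩)
    have hv' : (nU : ℝ) * c i + nF * (c i + c j) < u := by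
      simpa [c, mul_add] using hv
    rw [hfx, ← Finset.add_sum_erase _ _ (Finset.mem_univ i)] at hf2
    rw [← Finset.add_sum_erase _ _ (Finset.mem_univ i)] at hx
    have hle : ∑ k ∈ Finset.univ.erase i, x k * c k ≤ ∑ k ∈ Finset.univ.erase i, x k * c j :=
      Finset.sum_le_sum fun k hk => mul_le_mul_of_nonneg_left (hj' k hk) (hx' k).1
    rw [← Finset.sum_mul] at hle
    have hs : ∑ k ∈ Finset.univ.erase i, x k = nU + 2 * nF - x i := by linarith
    rw [hs] at hle
    have hcc := hi j (Finset.mem_univ _)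
    nlinarith [mul_nonneg (sub_nonneg.2 hcc) (sub_nonneg.2 (hx' i).2)]

theorem aux_int (N nU nF : ℕ) (hN : 4 ≤ N) (ht : ¬(nU = 0 ∧ nF = 0)) :
    intrinsicInterior ℝ
      {x : Fin N → ℝ | (∑ i, x i = nU + 2 * nF) ∧ ∀ i, 0 ≤ x i ∧ x i ≤ nU + nF} =
    {x : Fin N → ℝ | (∑ i, x i = nU + 2 * nF) ∧ ∀ i, 0 < x i ∧ x i < nU + nF} := by
  have hU : (0 : ℝ) ≤ nU := Nat.cast_nonneg _
  have hF : (0 : ℝ) ≤ nF := Nat.cast_nonneg _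
  have hM : (0 : ℝ) < nU + nF := by
    have : 0 < nU + nF := by omega
    exact_mod_cast this
  have hNR : (4 : ℝ) ≤ N := by exact_mod_cast hN
  ext x
  constructor
  · intro hx
    have hxs := intrinsicInterior_subset hx
    refine ⟨hxs.1, ?_⟩
    have hc0 : (0 : ℝ) < (nU + 2 * nF) / N := div_pos (by linarith) (by linarith)
    have hc1 : ((nU : ℝ) + 2 * nF) / N < nU + nF := by
      rw [div_lt_iff₀ (by linarith)]
      nlinarith
    obtain ⟨ε, hε, h⟩ := aux_ext hx (c := fun _ => ((nU : ℝ) + 2 * nF) / N) (by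
      refine ⟨?_, fun i => ⟨hc0.le, hc1.le⟩⟩
      simp
      field_simp)
    intro i
    have := h.2 i
    simp only [Pi.add_apply, Pi.smul_apply, Pi.sub_apply, smul_eq_mul] at this
    obtain ⟨h1, h2⟩ := this
    constructor
    · by_contra hneg
      nlinarith
    · by_contra hneg
      nlinarith
  · rintro ⟨hx, hx'⟩
    set P := {x : Fin N → ℝ | (∑ i, x i = nU + 2 * nF) ∧ ∀ i, 0 ≤ x i ∧ x i ≤ nU + nF} with hP
    have hxP : x ∈ P := ⟨hx, fun i => ⟨(hx' i).1.le, (hx' i).2.le⟩⟩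
    have hspan : ∀ y ∈ affineSpan ℝ P, ∑ i, y i = (nU : ℝ) + 2 * nF := by
      intro y hy
      refine affineSpan_induction (p := fun y : Fin N → ℝ => ∑ i, y i = (nU : ℝ) + 2 * nF)
        hy (fun y hy => hy.1) ?_
      intro t u v w hu hv hw
      simp [Finset.sum_add_distrib, ← Finset.mul_sum, hu, hv, hw]
    rw [mem_intrinsicInterior]
    refine ⟨⟨x, subset_affineSpan ℝ P hxP⟩, ?_, rfl⟩
    rw [mem_interior]
    refine ⟨{y | ∀ i, 0 < (y : Fin N → ℝ) i ∧ (y : Fin N → ℝ) i < nU + nF}, ?_, ?_, hx'⟩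
    · intro y hy
      exact ⟨hspan y y.2, fun i => ⟨(hy i).1.le, (hy i).2.le⟩⟩
    · simp only [Set.ofPred_forall]
      refine isOpen_iInter_of_finite fun i => ?_
      have hcont : Continuous fun y : affineSpan ℝ P => (y : Fin N → ℝ) i :=
        (continuous_apply i).comp continuous_subtype_val
      exact (isOpen_lt continuous_const hcont).inter (isOpen_lt hcont continuous_const)

theorem stmt6 (N nU nF : ℕ) (hN : 4 ≤ N) (ht : ¬(nU = 0 ∧ nF = 0)) :
    let Δ₁ : Set (Fin N → ℝ) :=
      convexHull ℝ (Set.range fun i : Fin N => (Pi.single i 1 : Fin N → ℝ))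
    let Δ₂ : Set (Fin N → ℝ) :=
      convexHull ℝ {x | ∃ r s : Fin N, r < s ∧
        x = (Pi.single r 1 : Fin N → ℝ) + (Pi.single s 1 : Fin N → ℝ)}
    let S : Set (Fin N → ℝ) :=
      {x | x ∈ intrinsicInterior ℝ ((nU : ℝ) • Δ₁ + (nF : ℝ) • Δ₂) ∧
        ∀ i, ∃ m : ℤ, x i = (m : ℝ)}
    ((∃! x, x ∈ S) ↔ nU + 2 * nF = N) ∧
    (nU + 2 * nF = N → S = {fun _ => (1 : ℝ)}) := by
  intro Δ₁ Δ₂ S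
  have : NeZero N := ⟨by omega⟩
  have hS : S = {x : Fin N → ℝ | ((∑ i, x i = (nU : ℝ) + 2 * nF) ∧ ∀ i, 0 < x i ∧ x i < (nU : ℝ) + nF) ∧
        ∀ i, ∃ m : ℤ, x i = (m : ℝ)} := by
    simp only [S, Δ₁, Δ₂]
    rw [aux_poly N nU nF hN, aux_int N nU nF hN ht]
    rfl
  have hNR : (4 : ℝ) ≤ N := by exact_mod_cast hN
  have hone : ∀ x ∈ S, ∀ i, 1 ≤ x i ∧ x i ≤ nU + nF - 1 := by
    intro x hx i
    rw [hS] at hx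
    obtain ⟨m, hm⟩ := hx.2 i
    have h := hx.1.2 i
    rw [hm] at h ⊢
    have h1 : 0 < m := by exact_mod_cast h.1
    have h2 : m < nU + nF := by exact_mod_cast h.2
    have h1' : 1 ≤ m := h1
    have h2' : m + 1 ≤ nU + nF := h2
    refine ⟨by exact_mod_cast h1', ?_⟩
    have : (m : ℝ) + 1 ≤ nU + nF := by exact_mod_cast h2'
    linarith
  have hEq : nU + 2 * nF = N → S = {fun _ => (1 : ℝ)} := by
    intro h
    have hR : (nU : ℝ) + 2 * nF = N := by exact_mod_cast h
    apply Set.Subset.antisymm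
    · intro x hx
      have h1 := hone x hx
      rw [hS] at hx
      have hs := hx.1.1
      have h0 : ∑ i, (x i - 1) = 0 := by
        rw [Finset.sum_sub_distrib, hs, hR]; simp
      rw [Finset.sum_eq_zero_iff_of_nonneg fun i _ => sub_nonneg.2 (h1 i).1] at h0
      rw [Set.mem_singleton_iff]
      funext i
      linarith [h0 i (Finset.mem_univ i)]
    · rintro _ rfl
      rw [hS]
      refine ⟨⟨by simp [hR], fun i => ⟨one_pos, ?_⟩⟩, fun i => ⟨1, by simp⟩⟩
      have : 1 < nU + nF := by omega
      show (1 : ℝ) < nU + nF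
      exact_mod_cast this
  refine ⟨⟨?_, fun h => ?_⟩, hEq⟩
  · rintro ⟨x, hx, huniq⟩
    have h1 := hone x hx
    have hx0 := hx
    rw [hS] at hx0
    obtain ⟨⟨hs, hb⟩, hint⟩ := hx0
    by_contra hd
    have hex : ∃ i, 1 < x i := by
      by_contra! hall
      apply hd
      have : ∑ i, x i = N := by
        rw [Finset.sum_congr rfl fun i _ => le_antisymm (hall i) (h1 i).1]; simp
      rw [this] at hs
      exact_mod_cast hs.symm
    obtain ⟨i, hi⟩ := hex
    have hi2 : 2 ≤ x i := by
      obtain ⟨m, hm⟩ := hint i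
      rw [hm] at hi ⊢
      have : 1 < m := by exact_mod_cast hi
      have : 2 ≤ m := this
      exact_mod_cast this
    have hF : (0 : ℝ) ≤ nF := Nat.cast_nonneg _
    have hU : (0 : ℝ) ≤ nU := Nat.cast_nonneg _
    have hexj : ∃ j, j ≠ i ∧ x j < nU + nF - 1 := by
      by_contra! hall
      have hcard : ∑ k ∈ Finset.univ.erase i, x k ≥
          ∑ k ∈ (Finset.univ.erase i : Finset (Fin N)), ((nU : ℝ) + nF - 1) :=
        Finset.sum_le_sum fun k hk => hall k (Finset.ne_of_mem_erase hk)
      rw [Finset.sum_const, Finset.card_erase_of_mem (Finset.mem_univ _), Finset.card_univ,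
        Fintype.card_fin, nsmul_eq_mul, Nat.cast_sub (by omega)] at hcard
      rw [← Finset.add_sum_erase _ _ (Finset.mem_univ i)] at hs
      have := (h1 i).2
      push_cast at hcard
      nlinarith
    obtain ⟨j, hji, hj⟩ := hexj
    have hj2 : x j + 1 < nU + nF := by linarith
    have hy : x + (Pi.single j 1 - Pi.single i 1 : Fin N → ℝ) ∈ S := by
      rw [hS]
      refine ⟨⟨?_, fun k => ?_⟩, fun k => ?_⟩
      · simp [Finset.sum_add_distrib, Finset.sum_sub_distrib, hs]
      · have := hb k
        simp only [Pi.add_apply, Pi.sub_apply, Pi.single_apply]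
        split_ifs with h h' h'
        · exact absurd (h.symm.trans h') hji
        · subst h; constructor <;> linarith
        · subst h'; constructor <;> linarith
        · constructor <;> linarith
      · obtain ⟨m, hm⟩ := hint k
        refine ⟨m + ((if k = j then 1 else 0) - (if k = i then 1 else 0)), ?_⟩
        simp only [Pi.add_apply, Pi.sub_apply, Pi.single_apply, hm]
        push_cast
        rfl
    have := congrFun (huniq _ hy) j
    simp [Pi.single_apply, hji] at this
  · rw [hEq h]
    exact ⟨_, rfl, fun y hy => hy⟩
end

section
/- Let f, g ∈ ℝ[x_1,…,x_n] be polynomials such that the Newton polytope of g is contained in the Newton polytope of f, and such that for every extreme point v of the Newton polytope of f, the coefficient of the monomial x^v in f − g is nonzero. Then the Newton polytope of f − g equals the Newton polytope of f. -/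
/-- Let `f, g` be real polynomials in `n` variables with `Δ(g) ⊆ Δ(f)`
(Newton polytopes), such that for every exponent vector `v` whose image is an extreme point
of `Δ(f)`, the coefficient of `x^v` in `f − g` is nonzero. Then `Δ(f − g) = Δ(f)`. -/
theorem stmt7 (n : ℕ) (f g : MvPolynomial (Fin n) ℝ) :
    let Newton : MvPolynomial (Fin n) ℝ → Set (Fin n → ℝ) := fun p =>
      convexHull ℝ ((fun a : Fin n →₀ ℕ => fun i => (a i : ℝ)) '' (p.support : Set (Fin n →₀ ℕ)))
    Newton g ⊆ Newton f →
    (∀ a : Fin n →₀ ℕ,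
        (fun i => (a i : ℝ)) ∈ Set.extremePoints ℝ (Newton f) →
        MvPolynomial.coeff a (f - g) ≠ 0) →
    Newton (f - g) = Newton f := by
  intro Newton hgf hv
  have hfin : ∀ p : MvPolynomial (Fin n) ℝ, ((fun a : Fin n →₀ ℕ => fun i => (a i : ℝ)) ''
      (p.support : Set (Fin n →₀ ℕ))).Finite := fun p => p.support.finite_toSet.image _
  apply Set.Subset.antisymm
  · refine convexHull_min ?_ (convex_convexHull ℝ _)
    rintro _ ⟨a, ha, rfl⟩
    have ha' : MvPolynomial.coeff a (f - g) ≠ 0 := MvPolynomial.mem_support_iff.1 ha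
    by_cases h : MvPolynomial.coeff a f = 0
    · have hg : MvPolynomial.coeff a g ≠ 0 := by
        intro h2
        apply ha'
        rw [MvPolynomial.coeff_sub, h, h2, sub_zero]
      exact hgf (subset_convexHull ℝ _ ⟨a, MvPolynomial.mem_support_iff.2 hg, rfl⟩)
    · exact subset_convexHull ℝ _ ⟨a, MvPolynomial.mem_support_iff.2 h, rfl⟩
  · have hc : IsCompact (Newton f) := (hfin f).isCompact_convexHull (𝕜 := ℝ)
    rw [← closure_convexHull_extremePoints hc (convex_convexHull ℝ _)]
    have hcl : IsClosed (Newton (f - g)) := (hfin (f - g)).isClosed_convexHull (𝕜 := ℝ)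
    refine closure_minimal (convexHull_min ?_ (convex_convexHull ℝ _)) hcl
    intro x hx
    obtain ⟨a, ha, rfl⟩ := extremePoints_convexHull_subset hx
    exact subset_convexHull ℝ _ ⟨a, MvPolynomial.mem_support_iff.2 (hv a hx), rfl⟩
end

section
/- Let f, g ∈ ℝ[x_1,…,x_n] be nonzero polynomials all of whose coefficients are nonnegative. Then the Newton polytope of the product f·g equals the Minkowski sum of the Newton polytopes of f and of g: Δ(f·g) = Δ(f) + Δ(g). -/
open Pointwise

/-- For nonzero real polynomials `f, g` in `n` variables with all
coefficients nonnegative, the Newton polytope of the product is the Minkowski sum of the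
Newton polytopes: `Δ(f·g) = Δ(f) + Δ(g)`. -/
theorem stmt8 (n : ℕ) (f g : MvPolynomial (Fin n) ℝ)
    (hf : f ≠ 0) (hg : g ≠ 0)
    (hfpos : ∀ a : Fin n →₀ ℕ, 0 ≤ MvPolynomial.coeff a f)
    (hgpos : ∀ a : Fin n →₀ ℕ, 0 ≤ MvPolynomial.coeff a g) :
    let Newton : MvPolynomial (Fin n) ℝ → Set (Fin n → ℝ) := fun p =>
      convexHull ℝ ((fun a : Fin n →₀ ℕ => fun i => (a i : ℝ)) '' (p.support : Set (Fin n →₀ ℕ)))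
    Newton (f * g) = Newton f + Newton g := by
  intro Newton
  have hs : ((f * g).support : Set (Fin n →₀ ℕ)) = (f.support : Set (Fin n →₀ ℕ)) + g.support := by
    classical
    apply Set.Subset.antisymm
    · rw [← Finset.coe_add]
      exact Finset.coe_subset.mpr (MvPolynomial.support_mul f g)
    · rintro _ ⟨a, ha, b, hb, rfl⟩
      simp only [Finset.mem_coe, MvPolynomial.mem_support_iff] at ha hb ⊢
      rw [MvPolynomial.coeff_mul]
      apply ne_of_gt
      apply Finset.sum_pos' (fun x _ => mul_nonneg (hfpos _) (hgpos _))
      exact ⟨(a, b), by simp, mul_pos ((hfpos a).lt_of_ne' ha) ((hgpos b).lt_of_ne' hb)⟩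
  simp only [Newton]
  rw [hs, ← convexHull_add]
  congr 1
  ext x
  constructor
  · rintro ⟨_, ⟨a, ha, b, hb, rfl⟩, rfl⟩
    refine ⟨_, ⟨a, ha, rfl⟩, _, ⟨b, hb, rfl⟩, ?_⟩
    funext i
    simp
  · rintro ⟨_, ⟨a, ha, rfl⟩, _, ⟨b, hb, rfl⟩, rfl⟩
    refine ⟨a + b, ⟨a, ha, b, hb, rfl⟩, ?_⟩
    funext i
    simp
end

section
/- Let u and f be nonzero polynomials in the variables x_1,…,x_n over ℝ with nonnegative coefficients, regarded as polynomials in the n+1 variables x_0,x_1,…,x_n, and let k ∈ ℕ. Then the Newton polytope of (x_0·u + f)^k in ℝ^{n+1} equals the convex hull of the union over a = 0,…,k of the sets {a} × (a·Δ(u) + (k−a)·Δ(f)), where Δ(u), Δ(f) ⊆ ℝ^n are the Newton polytopes of u and f and {a} × S denotes the embedding of S ⊆ ℝ^n into ℝ^{n+1} with first coordinate a. -/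
open Pointwise

open MvPolynomial in
lemma nn_mul {m : ℕ} {p q : MvPolynomial (Fin m) ℝ} (hp : ∀ a, 0 ≤ coeff a p)
    (hq : ∀ a, 0 ≤ coeff a q) : ∀ a, 0 ≤ coeff a (p * q) := by
  intro a
  rw [coeff_mul]
  exact Finset.sum_nonneg fun x _ => mul_nonneg (hp _) (hq _)

open MvPolynomial in
lemma supp_mul {m : ℕ} {p q : MvPolynomial (Fin m) ℝ} (hp : ∀ a, 0 ≤ coeff a p)
    (hq : ∀ a, 0 ≤ coeff a q) (a : Fin m →₀ ℕ) :
    a ∈ (p * q).support ↔ ∃ b ∈ p.support, ∃ c ∈ q.support, b + c = a := by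
  constructor
  · intro h
    have := MvPolynomial.support_mul p q h
    simpa [Finset.mem_add] using this
  · rintro ⟨b, hb, c, hc, rfl⟩
    rw [mem_support_iff] at *
    rw [coeff_mul]
    apply ne_of_gt
    apply Finset.sum_pos'
    · exact fun x _ => mul_nonneg (hp _) (hq _)
    · exact ⟨(b, c), by simp, mul_pos (lt_of_le_of_ne (hp _) hb.symm) (lt_of_le_of_ne (hq _) hc.symm)⟩

open MvPolynomial in
lemma supp_add {m : ℕ} {p q : MvPolynomial (Fin m) ℝ} (hp : ∀ a, 0 ≤ coeff a p)
    (hq : ∀ a, 0 ≤ coeff a q) (a : Fin m →₀ ℕ) :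
    a ∈ (p + q).support ↔ a ∈ p.support ∨ a ∈ q.support := by
  simp only [mem_support_iff, coeff_add]
  have h1 := hp a
  have h2 := hq a
  rw [Ne, add_eq_zero_iff_of_nonneg h1 h2]
  tauto

open MvPolynomial in
lemma nn_rename {n : ℕ} {p : MvPolynomial (Fin n) ℝ} (hp : ∀ a, 0 ≤ coeff a p) :
    ∀ a, 0 ≤ coeff a (rename Fin.succ p) := by
  intro a
  by_cases h : ∃ b, Finsupp.mapDomain Fin.succ b = a
  · obtain ⟨b, rfl⟩ := h
    rw [coeff_rename_mapDomain _ (Fin.succ_injective n)]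
    exact hp b
  · rw [coeff_rename_eq_zero]
    intro b hb
    exact absurd ⟨b, hb⟩ h

open MvPolynomial in
lemma supp_rename {n : ℕ} (p : MvPolynomial (Fin n) ℝ) (a : Fin (n + 1) →₀ ℕ) :
    a ∈ (rename Fin.succ p).support ↔ ∃ b ∈ p.support, Finsupp.mapDomain Fin.succ b = a := by
  classical
  rw [support_rename_of_injective (Fin.succ_injective n)]
  simp

/-- The set of real exponent vectors. -/
def expo {m : ℕ} (p : MvPolynomial (Fin m) ℝ) : Set (Fin m → ℝ) :=
  (fun a : Fin m →₀ ℕ => fun i => (a i : ℝ)) '' (p.support : Set (Fin m →₀ ℕ))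

open MvPolynomial in
lemma expo_mul {m : ℕ} {p q : MvPolynomial (Fin m) ℝ} (hp : ∀ a, 0 ≤ coeff a p)
    (hq : ∀ a, 0 ≤ coeff a q) : expo (p * q) = expo p + expo q := by
  ext x
  simp only [expo, Set.mem_add, Set.mem_image, Finset.mem_coe]
  constructor
  · rintro ⟨a, ha, rfl⟩
    obtain ⟨b, hb, c, hc, rfl⟩ := (supp_mul hp hq a).1 ha
    refine ⟨_, ⟨b, hb, rfl⟩, _, ⟨c, hc, rfl⟩, ?_⟩
    ext i
    simp
  · rintro ⟨_, ⟨b, hb, rfl⟩, _, ⟨c, hc, rfl⟩, rfl⟩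
    refine ⟨b + c, (supp_mul hp hq _).2 ⟨b, hb, c, hc, rfl⟩, ?_⟩
    ext i
    simp

lemma expo_nonempty {m : ℕ} {p : MvPolynomial (Fin m) ℝ} (hp : p ≠ 0) : (expo p).Nonempty := by
  have := MvPolynomial.support_nonempty.2 hp
  exact Set.Nonempty.image _ this

open MvPolynomial in
lemma nn_one {m : ℕ} (a : Fin m →₀ ℕ) : 0 ≤ coeff a (1 : MvPolynomial (Fin m) ℝ) := by
  classical
  rw [coeff_one]
  split_ifs <;> norm_num

open MvPolynomial in
lemma nn_pow {m : ℕ} {p : MvPolynomial (Fin m) ℝ} (hp : ∀ a, 0 ≤ coeff a p) (k : ℕ) :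
    ∀ a, 0 ≤ coeff a (p ^ k) := by
  induction k with
  | zero => simpa using nn_one
  | succ k ih => rw [pow_succ]; exact nn_mul ih hp

open MvPolynomial in
lemma hull_pow {m : ℕ} {p : MvPolynomial (Fin m) ℝ} (hp : ∀ a, 0 ≤ coeff a p) (h0 : p ≠ 0)
    (k : ℕ) : convexHull ℝ (expo (p ^ k)) = (k : ℝ) • convexHull ℝ (expo p) := by
  induction k with
  | zero =>
    have : expo (1 : MvPolynomial (Fin m) ℝ) = {0} := by
      ext x
      simp only [expo, Set.mem_image, Finset.mem_coe, support_one, Finset.mem_singleton,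
        exists_eq_left, Set.mem_singleton_iff]
      constructor
      · rintro rfl; ext i; simp
      · rintro rfl; ext i; simp
    rw [pow_zero, this, Nat.cast_zero, Set.zero_smul_set ((expo_nonempty h0).convexHull)]
    simp only [convexHull_singleton]
    rfl
  | succ k ih =>
    rw [pow_succ, expo_mul (nn_pow hp k) hp, convexHull_add, ih, Nat.cast_succ,
      (convex_convexHull ℝ _).add_smul (by positivity) zero_le_one, one_smul]

open MvPolynomial in
lemma nn_X {m : ℕ} (i : Fin m) (a : Fin m →₀ ℕ) :
    0 ≤ coeff a (X i : MvPolynomial (Fin m) ℝ) := by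
  classical
  rw [coeff_X']
  split_ifs <;> norm_num

open MvPolynomial in
lemma expo_rename {n : ℕ} (p : MvPolynomial (Fin n) ℝ) :
    expo (rename Fin.succ p) = (fun x : Fin n → ℝ => (Fin.cons 0 x : Fin (n + 1) → ℝ)) '' expo p := by
  have key : ∀ b : Fin n →₀ ℕ, (fun i => ((Finsupp.mapDomain Fin.succ b i : ℕ) : ℝ))
      = (Fin.cons 0 (fun i => (b i : ℝ)) : Fin (n + 1) → ℝ) := by
    intro b
    ext i
    refine Fin.cases ?_ (fun j => ?_) i
    · rw [Finsupp.mapDomain_notin_range]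
      · simp
      · rintro ⟨j, hj⟩; exact Fin.succ_ne_zero j hj
    · rw [Finsupp.mapDomain_apply (Fin.succ_injective n)]
      simp
  ext x
  simp only [expo, Set.mem_image, Finset.mem_coe, supp_rename]
  constructor
  · rintro ⟨_, ⟨b, hb, rfl⟩, rfl⟩
    exact ⟨_, ⟨b, hb, rfl⟩, (key b).symm⟩
  · rintro ⟨_, ⟨b, hb, rfl⟩, rfl⟩
    exact ⟨_, ⟨b, hb, rfl⟩, key b⟩

open MvPolynomial in
lemma expo_X {n : ℕ} : expo (X 0 : MvPolynomial (Fin (n + 1)) ℝ) = {Fin.cons 1 0} := by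
  have : (fun i => ((Finsupp.single (0 : Fin (n + 1)) 1 i : ℕ) : ℝ))
      = (Fin.cons 1 (0 : Fin n → ℝ) : Fin (n + 1) → ℝ) := by
    ext i
    refine Fin.cases ?_ (fun j => ?_) i <;> simp
  simp [expo, support_X, this]

open MvPolynomial in
lemma expo_g {n : ℕ} {u f : MvPolynomial (Fin n) ℝ} (hu : ∀ a, 0 ≤ coeff a u)
    (hf : ∀ a, 0 ≤ coeff a f) :
    expo (X 0 * rename Fin.succ u + rename Fin.succ f) =
      (fun x : Fin n → ℝ => (Fin.cons 1 x : Fin (n + 1) → ℝ)) '' expo u ∪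
      (fun x : Fin n → ℝ => (Fin.cons 0 x : Fin (n + 1) → ℝ)) '' expo f := by
  have h1 : expo (X 0 * rename Fin.succ u + rename Fin.succ f) =
      expo (X 0 * rename Fin.succ u) ∪ expo (rename Fin.succ f) := by
    rw [expo, expo, expo, ← Set.image_union]
    congr 1
    ext a
    simpa using supp_add (nn_mul (nn_X 0) (nn_rename hu)) (nn_rename hf) a
  rw [h1, expo_mul (nn_X 0) (nn_rename hu), expo_rename, expo_rename, expo_X,
    Set.singleton_add, Set.image_image]
  congr 2
  funext x i
  refine Fin.cases ?_ (fun j => ?_) i <;> simp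

lemma cons_hull {n : ℕ} (c : ℝ) (s : Set (Fin n → ℝ)) (t : Set (Fin (n + 1) → ℝ))
    (h : (fun x : Fin n → ℝ => (Fin.cons c x : Fin (n + 1) → ℝ)) '' s ⊆ t)
    {x : Fin n → ℝ} (hx : x ∈ convexHull ℝ s) :
    (Fin.cons c x : Fin (n + 1) → ℝ) ∈ convexHull ℝ t := by
  have hc : Convex ℝ {x : Fin n → ℝ | (Fin.cons c x : Fin (n + 1) → ℝ) ∈ convexHull ℝ t} := by
    intro x hx y hy a b ha hb hab
    have := convex_convexHull ℝ t hx hy ha hb hab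
    simp only [Set.mem_setOf_eq]
    convert this using 1
    funext i
    refine Fin.cases ?_ (fun j => ?_) i
    · simp [← add_mul, hab]
    · simp
  have hs : s ⊆ {x : Fin n → ℝ | (Fin.cons c x : Fin (n + 1) → ℝ) ∈ convexHull ℝ t} :=
    fun y hy => subset_convexHull ℝ t (h ⟨y, hy, rfl⟩)
  exact convexHull_min hs hc hx

/-- Let `u, f` be nonzero real polynomials in `x_1,…,x_n` with nonnegative
coefficients, viewed in the `n+1` variables `x_0,…,x_n`, and let `k ∈ ℕ`. Then the Newton
polytope of `(x_0·u + f)^k` in `ℝ^{n+1}` equals the convex hull of the union over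
`a = 0,…,k` of the sets `{a} × (a·Δ(u) + (k−a)·Δ(f))`. -/
theorem stmt9 (n : ℕ) (u f : MvPolynomial (Fin n) ℝ)
    (hu : u ≠ 0) (hf : f ≠ 0)
    (hupos : ∀ a : Fin n →₀ ℕ, 0 ≤ MvPolynomial.coeff a u)
    (hfpos : ∀ a : Fin n →₀ ℕ, 0 ≤ MvPolynomial.coeff a f)
    (k : ℕ) :
    let NewtonBig : MvPolynomial (Fin (n + 1)) ℝ → Set (Fin (n + 1) → ℝ) := fun p =>
      convexHull ℝ
        ((fun a : Fin (n + 1) →₀ ℕ => fun i => (a i : ℝ)) '' (p.support : Set (Fin (n + 1) →₀ ℕ)))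
    let Newton : MvPolynomial (Fin n) ℝ → Set (Fin n → ℝ) := fun p =>
      convexHull ℝ ((fun a : Fin n →₀ ℕ => fun i => (a i : ℝ)) '' (p.support : Set (Fin n →₀ ℕ)))
    NewtonBig ((MvPolynomial.X 0 * MvPolynomial.rename Fin.succ u
        + MvPolynomial.rename Fin.succ f) ^ k) =
      convexHull ℝ (⋃ a ∈ Finset.range (k + 1),
        (fun x : Fin n → ℝ => Fin.cons (a : ℝ) x) ''
          ((a : ℝ) • Newton u + ((k - a : ℕ) : ℝ) • Newton f)) := by
  intro NewtonBig Newton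
  have hup := expo_nonempty hu
  have hfp := expo_nonempty hf
  set g := MvPolynomial.X 0 * MvPolynomial.rename Fin.succ u + MvPolynomial.rename Fin.succ f
    with hg
  have hgn : ∀ a, 0 ≤ MvPolynomial.coeff a g := fun a => by
    rw [hg, MvPolynomial.coeff_add]
    exact add_nonneg (nn_mul (nn_X 0) (nn_rename hupos) a) (nn_rename hfpos a)
  have heg := expo_g hupos hfpos
  rw [← hg] at heg
  have hg0 : g ≠ 0 := by
    intro h0
    obtain ⟨y, hy⟩ := hup
    have : (Fin.cons 1 y : Fin (n + 1) → ℝ) ∈ expo g := by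
      rw [heg]; exact Or.inl ⟨y, hy, rfl⟩
    rw [h0] at this
    simp [expo] at this
  change convexHull ℝ (expo (g ^ k)) = convexHull ℝ (⋃ a ∈ Finset.range (k + 1),
        (fun x : Fin n → ℝ => (Fin.cons (a : ℝ) x : Fin (n + 1) → ℝ)) ''
          ((a : ℝ) • convexHull ℝ (expo u) + ((k - a : ℕ) : ℝ) • convexHull ℝ (expo f)))
  rw [hull_pow hgn hg0]
  apply Set.Subset.antisymm
  · rw [← convexHull_smul]
    apply convexHull_mono
    rw [heg]
    rintro _ ⟨_, ⟨x, hx, rfl⟩ | ⟨x, hx, rfl⟩, rfl⟩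
    · obtain ⟨y, hy⟩ := hfp
      refine Set.mem_iUnion₂.2 ⟨k, by simp, (k : ℝ) • x + ((k - k : ℕ) : ℝ) • y,
        Set.add_mem_add (Set.smul_mem_smul_set (subset_convexHull ℝ _ hx))
          (Set.smul_mem_smul_set (subset_convexHull ℝ _ hy)), ?_⟩
      funext i
      refine Fin.cases ?_ (fun j => ?_) i <;> simp
    · obtain ⟨y, hy⟩ := hup
      refine Set.mem_iUnion₂.2 ⟨0, by simp, ((0 : ℕ) : ℝ) • y + ((k - 0 : ℕ) : ℝ) • x,
        Set.add_mem_add (Set.smul_mem_smul_set (subset_convexHull ℝ _ hy))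
          (Set.smul_mem_smul_set (subset_convexHull ℝ _ hx)), ?_⟩
      funext i
      refine Fin.cases ?_ (fun j => ?_) i <;> simp
  · refine convexHull_min ?_ ((convex_convexHull ℝ _).smul _)
    intro z hz
    obtain ⟨a, ha, _, ⟨_, ⟨x, hx, rfl⟩, _, ⟨y, hy, rfl⟩, rfl⟩, rfl⟩ := Set.mem_iUnion₂.1 hz
    have hak : a ≤ k := by
      have := Finset.mem_range.1 ha
      omega
    have hk : (k : ℝ) = (a : ℝ) + ((k - a : ℕ) : ℝ) := by
      rw [← Nat.cast_add, Nat.add_sub_cancel' hak]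
    have hx' := cons_hull 1 (expo u) (expo g) (by rw [heg]; exact Set.subset_union_left) hx
    have hy' := cons_hull 0 (expo f) (expo g) (by rw [heg]; exact Set.subset_union_right) hy
    rw [hk, (convex_convexHull ℝ _).add_smul (by positivity) (by positivity)]
    refine ⟨_, Set.smul_mem_smul_set hx', _, Set.smul_mem_smul_set hy', ?_⟩
    funext i
    refine Fin.cases ?_ (fun j => ?_) i <;> simp
end

section
/- For every integer N ≥ 2, the Lebesgue integral over the open positive orthant (0,∞)^{N−1} of the function x ↦ (1 + x_1 + ⋯ + x_{N−1})^{−N} equals 1/(N−1)!. -/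
open MeasureTheory

lemma aux_one (n : ℕ) (a : ℝ) (ha : 0 < a) :
    ∫⁻ t in Set.Ioi (0:ℝ), ENNReal.ofReal (((a + t) ^ (n + 2))⁻¹)
      = ENNReal.ofReal (((n + 1 : ℝ))⁻¹) * ENNReal.ofReal ((a ^ (n + 1))⁻¹) := by
  have hd : ∀ x ∈ Set.Ici (0:ℝ), HasDerivAt
      (fun t : ℝ => -((n + 1 : ℝ)⁻¹ * ((a + t) ^ (n + 1))⁻¹)) (((a + x) ^ (n + 2))⁻¹) x := by
    intro x hx
    have hx' : (0:ℝ) ≤ x := hx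
    have hp : a + x ≠ 0 := by positivity
    have h1 : HasDerivAt (fun t : ℝ => a + t) 1 x := (hasDerivAt_id x).const_add a
    have h2 := (((h1.pow (n + 1)).inv (pow_ne_zero _ hp)).const_mul ((n + 1 : ℝ)⁻¹)).neg
    refine h2.congr_deriv ?_
    have hn : (n + 1 : ℝ) ≠ 0 := by positivity
    simp only [Pi.pow_apply, Nat.add_sub_cancel]
    push_cast
    field_simp
    ring
  have hpos : ∀ x ∈ Set.Ioi (0:ℝ), 0 ≤ ((a + x) ^ (n + 2))⁻¹ := by
    intro x hx
    have : (0:ℝ) < x := hx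
    positivity
  have ht : Filter.Tendsto (fun t : ℝ => -((n + 1 : ℝ)⁻¹ * ((a + t) ^ (n + 1))⁻¹))
      Filter.atTop (nhds 0) := by
    have h1 : Filter.Tendsto (fun t : ℝ => (a + t) ^ (n + 1)) Filter.atTop Filter.atTop :=
      (Filter.tendsto_pow_atTop (by omega)).comp
        (Filter.tendsto_atTop_add_const_left _ a Filter.tendsto_id)
    simpa using (h1.inv_tendsto_atTop.const_mul ((n + 1 : ℝ)⁻¹)).neg
  rw [← ofReal_integral_eq_lintegral_ofReal (integrableOn_Ioi_deriv_of_nonneg' hd hpos ht)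
    ((ae_restrict_iff' measurableSet_Ioi).2 (Filter.Eventually.of_forall hpos)),
    integral_Ioi_of_hasDerivAt_of_nonneg' hd hpos ht, ← ENNReal.ofReal_mul (by positivity)]
  simp

lemma aux_meas (n : ℕ) : MeasurableSet {x : Fin n → ℝ | ∀ i, 0 < x i} := by
  have : {x : Fin n → ℝ | ∀ i, 0 < x i} = Set.univ.pi (fun _ => Set.Ioi 0) := by
    ext; simp
  rw [this]
  exact MeasurableSet.univ_pi fun _ => measurableSet_Ioi

lemma aux_all (n : ℕ) :
    ∫⁻ x : Fin n → ℝ in {x | ∀ i, 0 < x i}, ENNReal.ofReal (((1 + ∑ i, x i) ^ (n + 1))⁻¹)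
      = ENNReal.ofReal ((n.factorial : ℝ)⁻¹) := by
  induction n with
  | zero =>
    simp [volume_pi]
  | succ n ih =>
    have mp := volume_preserving_piFinSuccAbove (fun _ : Fin (n + 1) => ℝ) 0
    have hs : {x : Fin (n + 1) → ℝ | ∀ i, 0 < x i} =
        (MeasurableEquiv.piFinSuccAbove (fun _ : Fin (n + 1) => ℝ) 0) ⁻¹'
          (Set.Ioi 0 ×ˢ {x : Fin n → ℝ | ∀ i, 0 < x i}) := by
      ext x
      simp [Fin.forall_fin_succ, Fin.tail, MeasurableEquiv.piFinSuccAbove,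
        Fin.insertNthEquiv]
    have h1 := mp.setLIntegral_comp_preimage_emb
      (MeasurableEquiv.measurableEmbedding _)
      (fun p : ℝ × (Fin n → ℝ) =>
        ENNReal.ofReal ((((1 + ∑ i, p.2 i) + p.1) ^ (n + 2))⁻¹))
      (Set.Ioi 0 ×ˢ {x : Fin n → ℝ | ∀ i, 0 < x i})
    rw [← hs] at h1
    have h2 : ∀ x : Fin (n + 1) → ℝ,
        ENNReal.ofReal (((1 + ∑ i, x i) ^ (n + 1 + 1))⁻¹) =
        (fun p : ℝ × (Fin n → ℝ) =>
        ENNReal.ofReal ((((1 + ∑ i, p.2 i) + p.1) ^ (n + 2))⁻¹))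
        ((MeasurableEquiv.piFinSuccAbove (fun _ : Fin (n + 1) => ℝ) 0) x) := by
      intro x
      simp only [Fin.sum_univ_succ, MeasurableEquiv.piFinSuccAbove, Fin.insertNthEquiv]
      simp [Fin.tail, add_comm, add_left_comm]
    simp_rw [h2]
    rw [h1, Measure.volume_eq_prod, ← Measure.prod_restrict, lintegral_prod_symm' _ (by fun_prop)]
    have h3 : ∀ y ∈ {x : Fin n → ℝ | ∀ i, 0 < x i},
        ∫⁻ t in Set.Ioi (0:ℝ), ENNReal.ofReal ((((1 + ∑ i, y i) + t) ^ (n + 2))⁻¹)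
        = ENNReal.ofReal (((n + 1 : ℝ))⁻¹) *
          ENNReal.ofReal (((1 + ∑ i, y i) ^ (n + 1))⁻¹) := by
      intro y hy
      have : 0 ≤ ∑ i, y i := Finset.sum_nonneg fun i _ => (hy i).le
      exact aux_one n _ (by positivity)
    rw [setLIntegral_congr_fun (aux_meas n) h3, lintegral_const_mul _ (by fun_prop), ih,
      ← ENNReal.ofReal_mul (by positivity), Nat.factorial_succ]
    push_cast
    rw [mul_inv]

/-- For `N ≥ 2`, the integral over the open positive orthant
`(0,∞)^{N−1}` of `(1 + x_1 + ⋯ + x_{N−1})^{−N}` equals `1/(N−1)!`. This is the finite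
one-loop `N`-gon Feynman period. -/
theorem stmt14 (N : ℕ) (hN : 2 ≤ N) :
    ∫ x : Fin (N - 1) → ℝ in {x | ∀ i, 0 < x i},
      ((1 + ∑ i, x i) ^ N)⁻¹ = 1 / (Nat.factorial (N - 1) : ℝ) := by
  obtain ⟨n, rfl⟩ : ∃ n, N = n + 1 := ⟨N - 1, by omega⟩
  change ∫ x : Fin n → ℝ in {x | ∀ i, 0 < x i},
      ((1 + ∑ i, x i) ^ (n + 1))⁻¹ = 1 / (Nat.factorial n : ℝ)
  rw [integral_eq_lintegral_of_nonneg_ae, aux_all, ENNReal.toReal_ofReal (by positivity), one_div]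
  · refine (ae_restrict_iff' (aux_meas n)).2 (Filter.Eventually.of_forall fun y hy => ?_)
    have : 0 ≤ ∑ i, y i := Finset.sum_nonneg fun i _ => (hy i).le
    simp only [Pi.zero_apply]
    positivity
  · exact Measurable.aestronglyMeasurable (by fun_prop)
end

section
/- For every integer L ≥ 1, the Lebesgue integral over the open positive orthant (0,∞)^L of the function x ↦ (∏_{i=1}^L x_i^{L−1}) / (∏_{j=1}^L x_j + ∑_{i=1}^L ∏_{j≤L, j≠i} x_j)^{L+1} equals 1/L!. -/
open MeasureTheory

lemma aux_one_s15 (c : ℝ) (hc : 0 < c) (k : ℕ) :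
    ∫⁻ x in Set.Ioi (0:ℝ), ENNReal.ofReal ((x^2)⁻¹ * ((c + x⁻¹)^(k+2))⁻¹)
      = ENNReal.ofReal ((c^(k+1))⁻¹ / (k+1)) := by
  have hd : ∀ x ∈ Set.Ici (0:ℝ), HasDerivAt (fun x : ℝ => (x / (c*x+1))^(k+1) / (k+1))
      (x^k / (c*x+1)^(k+2)) x := by
    intro x hx
    have hx : 0 ≤ x := hx
    have h1 : c*x+1 ≠ 0 := by positivity
    have h2 : HasDerivAt (fun x : ℝ => c*x+1) c x := by
      simpa using ((hasDerivAt_id x).const_mul c).add_const 1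
    have h3 := (((hasDerivAt_id x).div h2 h1).pow (k+1)).div_const ((k:ℝ)+1)
    refine h3.congr_deriv ?_
    have : (k:ℝ)+1 ≠ 0 := by positivity
    simp [div_pow]
    field_simp
    ring
  have hn : ∀ x ∈ Set.Ioi (0:ℝ), 0 ≤ x^k / (c*x+1)^(k+2) := by
    intro x hx
    have hx : 0 < x := hx
    positivity
  have ht : Filter.Tendsto (fun x : ℝ => (x / (c*x+1))^(k+1) / (k+1)) Filter.atTop
      (nhds ((c^(k+1))⁻¹ / (k+1))) := by
    have : Filter.Tendsto (fun x : ℝ => ((c+x⁻¹)⁻¹)^(k+1) / (k+1)) Filter.atTop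
        (nhds (((c+0)⁻¹)^(k+1) / (k+1))) :=
      (((tendsto_inv_atTop_zero.const_add c).inv₀ (by simpa using hc.ne')).pow _).div_const _
    simp only [add_zero, inv_pow c] at this
    refine this.congr' ?_
    filter_upwards [Filter.eventually_gt_atTop 0] with x hx
    congr 2
    field_simp
  have hi := integrableOn_Ioi_deriv_of_nonneg' hd hn ht
  have hv := integral_Ioi_of_hasDerivAt_of_nonneg' hd hn ht
  simp at hv
  have he : ∫⁻ x in Set.Ioi (0:ℝ), ENNReal.ofReal ((x^2)⁻¹ * ((c + x⁻¹)^(k+2))⁻¹)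
      = ∫⁻ x in Set.Ioi (0:ℝ), ENNReal.ofReal (x^k / (c*x+1)^(k+2)) := by
    refine setLIntegral_congr_fun measurableSet_Ioi ?_
    intro x hx
    have hx : 0 < x := hx
    have : c + x⁻¹ = (c*x+1)/x := by field_simp
    simp only [this, div_pow]
    congr 1
    have : c*x+1 ≠ 0 := by positivity
    field_simp
    ring
  rw [he, ← ofReal_integral_eq_lintegral_ofReal hi, hv]
  exact (ae_restrict_iff' measurableSet_Ioi).2 (Filter.Eventually.of_forall hn)

lemma aux_n (n : ℕ) : ∀ (k : ℕ) (c : ℝ), 0 < c →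
    ∫⁻ x, ENNReal.ofReal ((∏ i, (x i ^ 2)⁻¹) * ((c + ∑ i, (x i)⁻¹)^(n+k+1))⁻¹)
      ∂(Measure.pi (fun _ : Fin n => (volume : Measure ℝ).restrict (Set.Ioi 0)))
      = ENNReal.ofReal ((k.factorial : ℝ) / ((n+k).factorial) * (c^(k+1))⁻¹) := by
  induction n with
  | zero =>
    intro k c hc
    have : (k.factorial : ℝ) ≠ 0 := by positivity
    simp [this]
  | succ n ih =>
    intro k c hc
    have mp := measurePreserving_piFinSuccAbove
      (fun _ : Fin (n+1) => (volume : Measure ℝ).restrict (Set.Ioi 0)) 0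
    rw [← (mp.symm _).lintegral_comp_emb (MeasurableEquiv.measurableEmbedding _),
      lintegral_prod _ (by
        refine Measurable.aemeasurable ?_
        simp only [MeasurableEquiv.piFinSuccAbove_symm_apply, Fin.insertNthEquiv,
          Fin.prod_univ_succ, Fin.sum_univ_succ, Equiv.coe_fn_mk, Fin.insertNth_zero,
          Fin.cons_zero, Fin.cons_succ, cast_eq]
        fun_prop)]
    simp only [MeasurableEquiv.piFinSuccAbove_symm_apply, Fin.insertNthEquiv,
          Fin.prod_univ_succ, Fin.sum_univ_succ, Equiv.coe_fn_mk, Fin.insertNth_zero,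
          Fin.cons_zero, Fin.cons_succ, cast_eq]
    have key : ∀ x ∈ Set.Ioi (0:ℝ), ∫⁻ y : Fin n → ℝ, ENNReal.ofReal
        ((x^2)⁻¹ * (∏ i, (y i ^ 2)⁻¹) * ((c + (x⁻¹ + ∑ i, (y i)⁻¹))^(n+1+k+1))⁻¹)
        ∂(Measure.pi (fun _ : Fin n => (volume : Measure ℝ).restrict (Set.Ioi 0)))
        = ENNReal.ofReal (((k+1).factorial : ℝ) / ((n+(k+1)).factorial)) *
          ENNReal.ofReal ((x^2)⁻¹ * ((c + x⁻¹)^(k+2))⁻¹) := by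
      intro x hx
      have hx : 0 < x := hx
      have := ih (k+1) (c + x⁻¹) (by positivity)
      simp_rw [mul_assoc, ENNReal.ofReal_mul (show 0 ≤ (x^2)⁻¹ by positivity), ← add_assoc]
      rw [lintegral_const_mul _ (by fun_prop), show n+1+k+1 = n+(k+1)+1 by ring, this,
        ENNReal.ofReal_mul (by positivity)]
      simp only [add_assoc, Nat.reduceAdd]
      ring
    rw [setLIntegral_congr_fun measurableSet_Ioi key, lintegral_const_mul _ (by fun_prop),
      aux_one_s15 c hc k, ← ENNReal.ofReal_mul (by positivity)]
    congr 1
    rw [show n+1+k = n+(k+1) by ring, Nat.factorial_succ k]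
    push_cast
    field_simp

/-- For `L ≥ 1`, the integral over the open positive orthant `(0,∞)^L` of
`(∏ x_i^{L−1}) / (∏ x_j + ∑_i ∏_{j≠i} x_j)^{L+1}` equals `1/L!`. This is the `L`-loop sunset
period integral `I_⊙(L, 2L+2; (L,…,L))`. -/
theorem stmt15 (L : ℕ) (hL : 1 ≤ L) :
    ∫ x : Fin L → ℝ in {x | ∀ i, 0 < x i},
      (∏ i, x i ^ (L - 1)) /
        (((∏ j, x j) + ∑ i : Fin L, ∏ j ∈ Finset.univ.erase i, x j) ^ (L + 1)) =
      1 / (Nat.factorial L : ℝ) := by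
  have hs : {x : Fin L → ℝ | ∀ i, 0 < x i} = Set.univ.pi (fun _ => Set.Ioi 0) := by
    ext x; simp
  have hm : MeasurableSet {x : Fin L → ℝ | ∀ i, 0 < x i} := by
    rw [hs]; exact MeasurableSet.univ_pi (fun _ => measurableSet_Ioi)
  have hcong : ∀ x ∈ {x : Fin L → ℝ | ∀ i, 0 < x i}, (∏ i, x i ^ (L - 1)) /
        (((∏ j, x j) + ∑ i : Fin L, ∏ j ∈ Finset.univ.erase i, x j) ^ (L + 1)) =
        (∏ i, (x i ^ 2)⁻¹) * ((1 + ∑ i, (x i)⁻¹)^(L+0+1))⁻¹ := by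
    intro x hx
    have hx : ∀ i, 0 < x i := hx
    have hP : 0 < ∏ j, x j := Finset.prod_pos fun i _ => hx i
    have hS : 0 ≤ ∑ i, (x i)⁻¹ := Finset.sum_nonneg fun i _ => (inv_pos.2 (hx i)).le
    have e : ∀ i, ∏ j ∈ Finset.univ.erase i, x j = (∏ j, x j) * (x i)⁻¹ := by
      intro i
      rw [← Finset.mul_prod_erase _ _ (Finset.mem_univ i)]
      have := (hx i).ne'
      field_simp
    simp_rw [e]
    rw [← Finset.mul_sum, Finset.prod_pow, Finset.prod_inv_distrib, Finset.prod_pow]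
    generalize ∏ j, x j = P at *
    generalize ∑ i, (x i)⁻¹ = S at *
    obtain ⟨m, rfl⟩ : ∃ m, L = m + 1 := ⟨L - 1, by omega⟩
    rw [show P + P * S = P * (1+S) by ring, mul_pow]
    have : 1 + S ≠ 0 := by positivity
    simp only [Nat.add_sub_cancel, add_zero]
    field_simp
    ring
  rw [setIntegral_congr_fun hm hcong, integral_eq_lintegral_of_nonneg_ae]
  · rw [hs, volume_pi, Measure.restrict_pi_pi, aux_n L 0 1 one_pos, ENNReal.toReal_ofReal]
    · simp
    · positivity
  · refine (ae_restrict_iff' hm).2 (Filter.Eventually.of_forall ?_)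
    intro x hx
    have hx : ∀ i, 0 < x i := hx
    have hS : 0 ≤ ∑ i, (x i)⁻¹ := Finset.sum_nonneg fun i _ => (inv_pos.2 (hx i)).le
    have hP : 0 ≤ ∏ i, (x i ^ 2)⁻¹ := Finset.prod_nonneg fun i _ => by positivity
    simp only [Pi.zero_apply]
    positivity
  · exact Measurable.aestronglyMeasurable (by fun_prop)
end

section
/- Let U : (0,∞)^5 → ℝ be the polynomial U(x) = x_1x_2 + x_2x_3 + x_2x_5 + x_1x_3 + x_1x_4 + x_3x_4 + x_1x_5 + x_4x_5 + x_1x_2x_4 + x_2x_3x_4 + x_1x_2x_5 + x_2x_3x_5 + x_2x_4x_5 + x_1x_3x_4 + x_1x_3x_5 + x_3x_4x_5. Then the Lebesgue integral over the open positive orthant (0,∞)^5 of x ↦ U(x)^{−2} equals 6·∑_{n=1}^∞ 1/n³, i.e. 6ζ(3). -/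
open MeasureTheory

open Set Filter Topology in
lemma w3_ftc {F f : ℝ → ℝ} {a l : ℝ} (hd : ∀ x ∈ Ici a, HasDerivAt F (f x) x)
    (hf : ∀ x ∈ Ioi a, 0 ≤ f x) (hl : Tendsto F atTop (𝓝 l)) :
    ∫⁻ x in Ioi a, ENNReal.ofReal (f x) = ENNReal.ofReal (l - F a) := by
  rw [← integral_Ioi_of_hasDerivAt_of_nonneg' hd hf hl, ofReal_integral_eq_lintegral_ofReal]
  · exact integrableOn_Ioi_deriv_of_nonneg' hd hf hl
  · exact (ae_restrict_iff' measurableSet_Ioi).2 (ae_of_all _ hf)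

open Set in
lemma w3_scale {k : ℝ} (hk : 0 < k) (g : ℝ → ENNReal) :
    ∫⁻ x in Ioi (0:ℝ), g x = ∫⁻ x in Ioi (0:ℝ), ENNReal.ofReal k * g (k * x) := by
  have himg : (fun x => k * x) '' Ioi (0:ℝ) = Ioi 0 := by
    ext y
    simp only [mem_image, mem_Ioi]
    constructor
    · rintro ⟨x, hx, rfl⟩
      positivity
    · intro hy
      exact ⟨y / k, by positivity, by field_simp⟩
  have := lintegral_image_eq_lintegral_abs_deriv_mul (s := Ioi (0:ℝ)) (f := fun x => k * x)
    (f' := fun _ => k) measurableSet_Ioi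
    (fun x _ => by simpa using ((hasDerivAt_id x).const_mul k).hasDerivWithinAt)
    (fun x _ y _ h => by simpa [hk.ne'] using h) g
  rw [himg] at this
  rw [this, abs_of_pos hk]

open Set Filter Topology in
lemma w3_lim (A B C D : ℝ) (hC : 0 < C) :
    Tendsto (fun x => (A * x + B) / (C * x + D)) atTop (𝓝 (A / C)) := by
  have h1 : Tendsto (fun x : ℝ => (A + B * x⁻¹) / (C + D * x⁻¹)) atTop
      (𝓝 ((A + B * 0) / (C + D * 0))) := by
    apply Tendsto.div
    · exact tendsto_const_nhds.add (tendsto_inv_atTop_zero.const_mul B)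
    · exact tendsto_const_nhds.add (tendsto_inv_atTop_zero.const_mul D)
    · simpa using hC.ne'
  simp only [mul_zero, add_zero] at h1
  refine h1.congr' ?_
  filter_upwards [eventually_gt_atTop 0] with x hx
  have : (A * x + B) / (C * x + D) = ((A + B * x⁻¹) * x) / ((C + D * x⁻¹) * x) := by
    congr 1 <;> field_simp
  rw [this, mul_div_mul_right _ _ hx.ne']

open Set Filter Topology in
/-- rational integral, step 1 -/
lemma w3_int1 {P Q : ℝ} (hP : 0 < P) (hQ : 0 < Q) :
    ∫⁻ x in Ioi (0:ℝ), ENNReal.ofReal ((P * x + Q) ^ 2)⁻¹ = ENNReal.ofReal (P * Q)⁻¹ := by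
  rw [w3_ftc (F := fun x => (-1 / P) * (P * x + Q)⁻¹) (l := (-1/P) * 0)]
  · congr 1; field_simp; ring
  · intro x hx
    have hx : 0 ≤ x := hx
    have h0 : P * x + Q ≠ 0 := by positivity
    have := ((((hasDerivAt_id x).const_mul P).add_const Q).inv h0).const_mul (-1 / P)
    refine this.congr_deriv ?_
    simp only [id, Pi.div_apply]; field_simp
  · intro x hx; positivity
  · refine Tendsto.const_mul _ (tendsto_inv_atTop_zero.comp ?_)
    exact tendsto_atTop_add_const_right _ _ (tendsto_id.const_mul_atTop hP)

open Set Filter Topology in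
lemma w3_int2 {A B C D : ℝ} (hA : 0 < A) (hB : 0 < B) (hC : 0 < C) (hD : 0 < D)
    (h : A * D < B * C) :
    ∫⁻ x in Ioi (0:ℝ), ENNReal.ofReal ((A * x + B) * (C * x + D))⁻¹ =
      ENNReal.ofReal (Real.log (B * C / (A * D)) / (B * C - A * D)) := by
  have hE : 0 < B * C - A * D := by linarith
  have hlim : Tendsto (fun x => (Real.log ((C * x + D) / (A * x + B))) / (B * C - A * D)) atTop
      (𝓝 ((Real.log (C / A)) / (B * C - A * D))) := by
    refine Tendsto.div_const ?_ _
    exact ((Real.continuousAt_log (by positivity)).tendsto).comp (w3_lim C D A B hA)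
  rw [w3_ftc _ _ hlim]
  · congr 1
    rw [← sub_div]
    congr 1
    rw [← Real.log_div (by positivity) (by simp; exact ⟨hD.ne', hB.ne'⟩)]
    congr 1
    simp only [mul_zero, zero_add]; field_simp
  · intro x hx
    have hx : 0 ≤ x := hx
    have h0 : A * x + B ≠ 0 := by positivity
    have h1 : C * x + D ≠ 0 := by positivity
    have := ((((((hasDerivAt_id x).const_mul C).add_const D).div
      (((hasDerivAt_id x).const_mul A).add_const B) h0).log (by simp; exact ⟨h1, h0⟩)).div_const
        (B * C - A * D))
    refine this.congr_deriv ?_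
    simp only [id, Pi.div_apply]
    rw [show C * 1 * (A * x + B) - (C * x + D) * (A * 1) = B * C - A * D by ring]
    generalize B * C - A * D = E at hE
    have := hE.ne'
    field_simp
  · intro x hx
    have hx : 0 < x := hx
    positivity

/-- `log (1 + 1/z)` -/
noncomputable def w3L (z : ℝ) : ℝ := Real.log ((1 + z) / z)

open Set Filter Topology in
lemma w3L_lim : Tendsto w3L atTop (𝓝 0) := by
  have := ((Real.continuousAt_log (x := (1:ℝ)/1) (by norm_num)).tendsto).comp
    (w3_lim 1 1 1 0 one_pos)
  simp only [div_one, Real.log_one] at this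
  refine this.congr fun x => ?_
  simp [w3L, add_comm]

lemma w3L_deriv {y : ℝ} (hy : 0 < y) : HasDerivAt w3L (-(y * (1 + y))⁻¹) y := by
  have := ((((hasDerivAt_id y).const_add 1).div (hasDerivAt_id y) hy.ne').log
    (by simp; exact ⟨by positivity, hy.ne'⟩))
  refine this.congr_deriv ?_
  simp only [id, Pi.div_apply]; field_simp; ring

lemma w3L_pos {y : ℝ} (hy : 0 < y) : 0 < w3L y := by
  apply Real.log_pos
  rw [lt_div_iff₀ hy]; linarith

@[fun_prop]
lemma w3L_meas : Measurable w3L := by unfold w3L; fun_prop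

open Set Filter Topology in
lemma w3_intL {z : ℝ} (hz : 0 < z) :
    ∫⁻ y in Ioi z, ENNReal.ofReal (2 * w3L y / (y * (1 + y))) = ENNReal.ofReal (w3L z ^ 2) := by
  have hlim : Tendsto (fun y => -(w3L y)^2) atTop (𝓝 (-0^2)) := (w3L_lim.pow 2).neg
  rw [w3_ftc _ _ hlim]
  · simp
  · intro y hy
    have hy : 0 < y := lt_of_lt_of_le hz hy
    have := ((w3L_deriv hy).pow 2).neg
    refine this.congr_deriv ?_
    simp; field_simp
  · intro y hy
    have hy : 0 < y := lt_trans hz hy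
    have := w3L_pos hy
    positivity

open Set Filter Topology in
lemma w3_intlog {z κ : ℝ} (hz : 0 < z) (hκ : 0 < κ) :
    ∫⁻ y in Ioi z, ENNReal.ofReal (κ * (1 + 2 * y) / (y * (1 + y) * (y * (1 + y) + κ))) =
      ENNReal.ofReal (Real.log (1 + κ / (z * (1 + z)))) := by
  have hlim0 : Tendsto (fun y : ℝ => 1 + κ / (y * (1 + y))) atTop (𝓝 (1 + 0)) := by
    refine tendsto_const_nhds.add (Tendsto.const_div_atTop ?_ κ)
    exact tendsto_id.atTop_mul_atTop₀ (tendsto_atTop_add_const_left _ _ tendsto_id)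
  have hlim : Tendsto (fun y : ℝ => -Real.log (1 + κ / (y * (1 + y)))) atTop
      (𝓝 (-Real.log (1+0))) := 
    (((Real.continuousAt_log (x := (1:ℝ)+0) (by norm_num)).tendsto).comp hlim0).neg
  rw [w3_ftc _ _ hlim]
  · simp
  · intro y hy
    have hy : 0 < y := lt_of_lt_of_le hz hy
    have h0 : y * (1 + y) ≠ 0 := by positivity
    have h1 : 1 + κ / (y * (1 + y)) ≠ 0 := by positivity
    have := (((((hasDerivAt_const y κ).div ((hasDerivAt_id y).mul
      ((hasDerivAt_id y).const_add 1)) h0)).const_add 1).log h1).neg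
    refine this.congr_deriv ?_
    simp only [id, Pi.mul_apply, Pi.div_apply]; field_simp; ring
  · intro y hy
    have hy : 0 < y := lt_trans hz hy
    positivity

open Set Filter Topology in
lemma w3_inte {y : ℝ} (hy : 0 < y) :
    ∫⁻ e in Ioi (0:ℝ), ENNReal.ofReal ((1 + 2 * y) / (y * (1 + y)) *
      ((y * e + (1 + y)) * ((1 + y) * e + y))⁻¹) = ENNReal.ofReal (2 * w3L y / (y * (1 + y))) := by
  have h0 : 0 ≤ (1 + 2 * y) / (y * (1 + y)) := by positivity
  simp_rw [ENNReal.ofReal_mul h0]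
  rw [lintegral_const_mul' _ _ ENNReal.ofReal_ne_top, w3_int2 hy (by positivity) (by positivity) hy
    (by nlinarith), ← ENNReal.ofReal_mul h0]
  congr 1
  have : (1 + y) * (1 + y) / (y * y) = ((1 + y) / y) ^ 2 := by field_simp
  rw [this, Real.log_pow, w3L]
  have h2 : (1 + y) * (1 + y) - y * y = 1 + 2 * y := by ring
  rw [h2]
  push_cast
  field_simp

open Set Filter Topology in
lemma w3_gamma (n : ℕ) :
    ∫⁻ l in Ioi (0:ℝ), ENNReal.ofReal (l ^ 3 * (((n + 1 : ℕ) : ℝ) * Real.exp (-l) ^ (n + 1))) =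
      ENNReal.ofReal (6 * (1 / ((n : ℝ) + 1) ^ 3)) := by
  have hr : (0:ℝ) < (n:ℝ) + 1 := by positivity
  have h := Real.integral_rpow_mul_exp_neg_mul_Ioi (a := 4) (r := (n:ℝ)+1) (by norm_num) hr
  have hG : Real.Gamma 4 = 6 := by
    have := Real.Gamma_nat_eq_factorial 3
    rw [show ((3:ℕ):ℝ) + 1 = 4 by norm_num] at this
    rw [this]; norm_num [Nat.factorial]
  have hne : (∫ t in Ioi (0:ℝ), t ^ ((4:ℝ) - 1) * Real.exp (-(((n:ℝ)+1) * t))) ≠ 0 := by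
    rw [h, hG]; positivity
  have hint : IntegrableOn (fun t : ℝ => t ^ ((4:ℝ) - 1) * Real.exp (-(((n:ℝ)+1) * t))) (Ioi 0) := by
    by_contra hc
    exact hne (integral_undef hc)
  have h2 : ∫⁻ l in Ioi (0:ℝ), ENNReal.ofReal (l ^ ((4:ℝ) - 1) * Real.exp (-(((n:ℝ)+1) * l))) =
      ENNReal.ofReal ((1 / ((n:ℝ)+1)) ^ (4:ℝ) * 6) := by
    rw [← hG, ← h, ofReal_integral_eq_lintegral_ofReal hint]
    refine (ae_restrict_iff' measurableSet_Ioi).2 (ae_of_all _ fun t ht => ?_)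
    have ht : 0 < t := ht
    simp only [Pi.zero_apply]
    positivity
  calc _ = ∫⁻ l in Ioi (0:ℝ), ENNReal.ofReal ((n:ℝ)+1) *
        ENNReal.ofReal (l ^ ((4:ℝ) - 1) * Real.exp (-(((n:ℝ)+1) * l))) := by
        refine setLIntegral_congr_fun measurableSet_Ioi fun l hl => ?_
        beta_reduce
        rw [← ENNReal.ofReal_mul hr.le, ← Real.exp_nat_mul]
        congr 1
        have : ((4:ℝ) - 1) = ((3:ℕ):ℝ) := by norm_num
        rw [this, Real.rpow_natCast]
        push_cast
        rw [mul_neg]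
        ring
    _ = _ := by
        rw [lintegral_const_mul' _ _ ENNReal.ofReal_ne_top, h2, ← ENNReal.ofReal_mul hr.le]
        congr 1
        have : (4:ℝ) = ((4:ℕ):ℝ) := by norm_num
        rw [this, Real.rpow_natCast]
        field_simp

lemma w3_summable : Summable (fun n : ℕ => 1 / ((n : ℝ) + 1) ^ 3) := by
  have := (summable_nat_add_iff 1).2 (Real.summable_one_div_nat_pow.2 (show 1 < 3 by norm_num))
  simpa using this

open Set Filter Topology in
lemma w3_last : ∫⁻ z in Ioi (0:ℝ), ENNReal.ofReal (w3L z ^ 3) =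
    ENNReal.ofReal (6 * ∑' n : ℕ, 1 / ((n : ℝ) + 1) ^ 3) := by
  have hexp : ∀ l : ℝ, 0 < l → 0 < Real.exp l - 1 := fun l hl => by
    have := Real.add_one_lt_exp hl.ne'; linarith
  have hinv : ∀ l : ℝ, 0 < l → w3L (Real.exp l - 1)⁻¹ = l := fun l hl => by
    have := hexp l hl
    rw [w3L]
    have h : (1 + (Real.exp l - 1)⁻¹) / (Real.exp l - 1)⁻¹ = Real.exp l := by
      field_simp; ring
    rw [h, Real.log_exp]
  have himg : (fun l => (Real.exp l - 1)⁻¹) '' Ioi (0:ℝ) = Ioi 0 := by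
    ext y
    simp only [mem_image, mem_Ioi]
    constructor
    · rintro ⟨x, hx, rfl⟩
      exact inv_pos.2 (hexp x hx)
    · intro hy
      refine ⟨w3L y, w3L_pos hy, ?_⟩
      rw [w3L, Real.exp_log (by positivity)]
      field_simp; ring
  have := lintegral_image_eq_lintegral_abs_deriv_mul (s := Ioi (0:ℝ))
    (f := fun l => (Real.exp l - 1)⁻¹)
    (f' := fun l => - (Real.exp l) / (Real.exp l - 1)^2) measurableSet_Ioi
    (fun x hx => (((Real.hasDerivAt_exp x).sub_const 1).inv (hexp x hx).ne').hasDerivWithinAt)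
    (fun x hx y hy h => by
      rw [← hinv x hx, ← hinv y hy]; simp only at h; rw [h])
    (fun z => ENNReal.ofReal (w3L z ^ 3))
  rw [himg] at this
  rw [this]
  calc _ = ∫⁻ l in Ioi (0:ℝ), ∑' n : ℕ,
      ENNReal.ofReal (l ^ 3 * (((n + 1 : ℕ) : ℝ) * Real.exp (-l) ^ (n + 1))) := by
        refine setLIntegral_congr_fun measurableSet_Ioi fun l hl => ?_
        have hl : 0 < l := hl
        have h1 := hexp l hl
        have hs : HasSum (fun n : ℕ => l ^ 3 * (((n + 1 : ℕ) : ℝ) * Real.exp (-l) ^ (n + 1)))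
            (l ^ 3 * (Real.exp (-l) / (1 - Real.exp (-l)) ^ 2)) := by
          refine HasSum.mul_left _ ?_
          have h0 := hasSum_coe_mul_geometric_of_norm_lt_one (𝕜 := ℝ) (r := Real.exp (-l))
            (by rw [Real.norm_eq_abs, abs_of_pos (Real.exp_pos _)]; simpa using hl)
          have := (hasSum_nat_add_iff' 1).2 h0
          simpa using this
        beta_reduce
        rw [← ENNReal.ofReal_tsum_of_nonneg (fun n => by positivity) hs.summable, hs.tsum_eq,
          hinv l hl, ← ENNReal.ofReal_mul (abs_nonneg _), abs_div, abs_neg,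
          abs_of_pos (Real.exp_pos l), abs_of_nonneg (sq_nonneg _)]
        congr 1
        rw [mul_comm]
        congr 1
        rw [Real.exp_neg]
        have := Real.exp_pos l
        have h3 : 1 - (Real.exp l)⁻¹ ≠ 0 := by
          have : 1 - (Real.exp l)⁻¹ = (Real.exp l - 1) / Real.exp l := by field_simp
          rw [this]; positivity
        have h4 : 1 - (Real.exp l)⁻¹ = (Real.exp l - 1) / Real.exp l := by field_simp
        rw [h4]
        field_simp
    _ = _ := by
        rw [lintegral_tsum (fun n => by fun_prop)]
        simp_rw [w3_gamma]
        rw [← ENNReal.ofReal_tsum_of_nonneg (fun n => by positivity) (w3_summable.mul_left 6),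
          tsum_mul_left]

/-- split off the first coordinate -/
lemma w3_split (n : ℕ) (f : (Fin (n + 1) → ℝ) → ENNReal) (hf : Measurable f) :
    ∫⁻ x in {x : Fin (n + 1) → ℝ | ∀ i, 0 < x i}, f x =
      ∫⁻ y in {y : Fin n → ℝ | ∀ i, 0 < y i}, ∫⁻ t in Set.Ioi (0:ℝ), f (Fin.cons t y) := by
  have hmp := (volume_preserving_piFinSuccAbove (fun _ : Fin (n + 1) => ℝ) 0).symm
  rw [← hmp.setLIntegral_comp_preimage_emb (MeasurableEquiv.measurableEmbedding _)]
  have hset : ((MeasurableEquiv.piFinSuccAbove (fun _ : Fin (n + 1) => ℝ) 0).symm ⁻¹'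
      {x : Fin (n + 1) → ℝ | ∀ i, 0 < x i}) =
      Set.Ioi (0:ℝ) ×ˢ {y : Fin n → ℝ | ∀ i, 0 < y i} := by
    ext ⟨t, y⟩
    simp [MeasurableEquiv.piFinSuccAbove, Fin.forall_fin_succ]
  rw [hset, Measure.volume_eq_prod, ← Measure.prod_restrict, lintegral_prod_symm]
  · simp only [MeasurableEquiv.piFinSuccAbove, Fin.insertNthEquiv_zero]
    rfl
  · exact (hf.comp (MeasurableEquiv.measurable _)).aemeasurable

open Set in
lemma w3_iter (f : (Fin 5 → ℝ) → ENNReal) (hf : Measurable f) :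
    ∫⁻ x in {x : Fin 5 → ℝ | ∀ i, 0 < x i}, f x =
      ∫⁻ e in Ioi (0:ℝ), ∫⁻ d in Ioi (0:ℝ), ∫⁻ c in Ioi (0:ℝ), ∫⁻ b in Ioi (0:ℝ),
        ∫⁻ a in Ioi (0:ℝ), f ![a, b, c, d, e] := by
  have hc : ∀ n, Measurable (fun p : (Fin n → ℝ) × ℝ => (Fin.cons p.2 p.1 : Fin (n+1) → ℝ)) := by
    intro n
    refine measurable_pi_iff.2 (Fin.cases ?_ ?_)
    · simpa using measurable_snd
    · intro i; simp only [Fin.cons_succ]; fun_prop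
  have key : ∀ (n : ℕ) (g : (Fin (n+1) → ℝ) → ENNReal), Measurable g →
      Measurable (fun y : Fin n → ℝ => ∫⁻ t in Ioi (0:ℝ), g (Fin.cons t y)) := by
    intro n g hg
    exact Measurable.lintegral_prod_right' (f := fun p : (Fin n → ℝ) × ℝ => g (Fin.cons p.2 p.1))
      (hg.comp (hc n))
  have h4 := key 4 f hf
  have h3 := key 3 _ h4
  have h2 := key 2 _ h3
  have h1 := key 1 _ h2
  have h0 := key 0 _ h1
  rw [w3_split 4 _ hf, w3_split 3 _ h4, w3_split 2 _ h3, w3_split 1 _ h2, w3_split 0 _ h1]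
  have : {y : Fin 0 → ℝ | ∀ i, 0 < y i} = univ := by ext; simp
  rw [this, Measure.restrict_univ, Measure.volume_pi_eq_dirac (fun i => i.elim0), lintegral_dirac' _ h0]
  rfl

open Set in
lemma w3_stepAB {c d e : ℝ} (hc : 0 < c) (hd : 0 < d) (he : 0 < e) :
    ∫⁻ b in Ioi (0:ℝ), ∫⁻ a in Ioi (0:ℝ), ENNReal.ofReal ((a * b + b * c + b * e + a * c + a * d +
          c * d + a * e + d * e +
          a * b * d + b * c * d + a * b * e + b * c * e +
          b * d * e + a * c * d + a * c * e + c * d * e) ^ 2)⁻¹ =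
    ENNReal.ofReal (Real.log (((c * (1 + d + e) + d + e) * (c * (1 + d + e) + e * (1 + d))) /
      ((1 + d + e) * (d * (e + c * (1 + e))))) / (c * (1 + d + e) + e) ^ 2) := by
  have h : ∀ b ∈ Ioi (0:ℝ), ∫⁻ a in Ioi (0:ℝ), ENNReal.ofReal ((a * b + b * c + b * e + a * c +
          a * d + c * d + a * e + d * e +
          a * b * d + b * c * d + a * b * e + b * c * e +
          b * d * e + a * c * d + a * c * e + c * d * e) ^ 2)⁻¹ =
      ENNReal.ofReal (((1 + d + e) * b + (c * (1 + d + e) + d + e)) *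
        ((c * (1 + d + e) + e * (1 + d)) * b + d * (e + c * (1 + e))))⁻¹ := by
    intro b hb
    have hb : 0 < b := hb
    rw [← w3_int1 (by positivity) (by positivity)]
    refine lintegral_congr fun a => ?_
    congr 3
    ring
  have key : (c * (1 + d + e) + d + e) * (c * (1 + d + e) + e * (1 + d)) -
      (1 + d + e) * (d * (e + c * (1 + e))) = (c * (1 + d + e) + e) ^ 2 := by ring
  rw [setLIntegral_congr_fun measurableSet_Ioi h, w3_int2 (by positivity) (by positivity)
    (by positivity) (by positivity), key]
  have : 0 < (c * (1 + d + e) + e) ^ 2 := by positivity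
  linarith

open Set in
lemma w3_stepC {d e : ℝ} (hd : 0 < d) (he : 0 < e) :
    ∫⁻ c in Ioi (0:ℝ), ENNReal.ofReal (Real.log (((c * (1 + d + e) + d + e) *
      (c * (1 + d + e) + e * (1 + d))) /
      ((1 + d + e) * (d * (e + c * (1 + e))))) / (c * (1 + d + e) + e) ^ 2) =
    ∫⁻ s in Ioi (0:ℝ), ENNReal.ofReal (Real.log (((e * (1 + s) + d) * (1 + s + d)) /
      (d * ((1 + s) * (1 + e) + d))) / (e * (1 + d + e) * (1 + s) ^ 2)) := by
  have hk : 0 < e / (1 + d + e) := by positivity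
  rw [w3_scale hk]
  refine setLIntegral_congr_fun measurableSet_Ioi fun s hs => ?_
  have hs : 0 < s := hs
  beta_reduce
  rw [← ENNReal.ofReal_mul hk.le]
  have h1 : e / (1 + d + e) * s * (1 + d + e) = e * s := by field_simp
  have h2 : (1 + d + e) * (d * (e + e / (1 + d + e) * s * (1 + e))) =
    e * (d * ((1 + s) * (1 + e) + d)) := by field_simp; ring
  have h3 : (e * s + d + e) * (e * s + e * (1 + d)) = e * ((e * (1 + s) + d) * (1 + s + d)) := by
    ring
  rw [h1, h2, h3, mul_div_mul_left _ _ he.ne', show e * s + e = e * (1 + s) by ring]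
  congr 1
  generalize Real.log _ = l
  field_simp

open Set in
lemma w3_stepD {e : ℝ} (he : 0 < e) :
    ∫⁻ d in Ioi (0:ℝ), ∫⁻ s in Ioi (0:ℝ), ENNReal.ofReal (Real.log (((e * (1 + s) + d) *
      (1 + s + d)) / (d * ((1 + s) * (1 + e) + d))) / (e * (1 + d + e) * (1 + s) ^ 2)) =
    ∫⁻ δ in Ioi (0:ℝ), ENNReal.ofReal (Real.log (1 + e / (δ * (1 + e + δ))) / e *
      (Real.log ((1 + e + δ) / δ) / (1 + e))) := by
  rw [lintegral_lintegral_swap (by fun_prop)]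
  calc _ = ∫⁻ s in Ioi (0:ℝ), ∫⁻ δ in Ioi (0:ℝ), ENNReal.ofReal
        (Real.log (1 + e / (δ * (1 + e + δ))) / e * ((δ * s + (1 + e + δ)) * (1 * s + 1))⁻¹) := by
        refine setLIntegral_congr_fun measurableSet_Ioi fun s hs => ?_
        have hs : 0 < s := hs
        have hk : 0 < 1 + s := by positivity
        beta_reduce
        rw [w3_scale hk]
        refine setLIntegral_congr_fun measurableSet_Ioi fun δ hδ => ?_
        have hδ : 0 < δ := hδ
        beta_reduce
        rw [← ENNReal.ofReal_mul hk.le]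
        have h1 : ((e * (1 + s) + (1 + s) * δ) * (1 + s + (1 + s) * δ)) /
            ((1 + s) * δ * ((1 + s) * (1 + e) + (1 + s) * δ)) = 1 + e / (δ * (1 + e + δ)) := by
          have : (1 + s) * (1 + e) + (1 + s) * δ = (1 + s) * (1 + e + δ) := by ring
          rw [this]
          field_simp
          ring
        rw [h1]
        congr 1
        generalize Real.log _ = l
        have h2 : δ * s + (1 + e + δ) = 1 + (1 + s) * δ + e := by ring
        rw [h2, one_mul, add_comm s 1]
        field_simp
    _ = _ := by
        rw [lintegral_lintegral_swap (by fun_prop)]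
        refine setLIntegral_congr_fun measurableSet_Ioi fun δ hδ => ?_
        have hδ : 0 < δ := hδ
        have h0 : 0 ≤ Real.log (1 + e / (δ * (1 + e + δ))) / e := by
          refine div_nonneg (Real.log_nonneg ?_) he.le
          have : 0 < e / (δ * (1 + e + δ)) := by positivity
          linarith
        simp_rw [ENNReal.ofReal_mul h0]
        rw [lintegral_const_mul' _ _ ENNReal.ofReal_ne_top, w3_int2 hδ (by positivity) one_pos
          one_pos (by linarith)]
        congr 3
        · simp
        · ring

open Set in
lemma w3_stepE {e : ℝ} (he : 0 < e) :
    ∫⁻ δ in Ioi (0:ℝ), ENNReal.ofReal (Real.log (1 + e / (δ * (1 + e + δ))) / e *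
      (Real.log ((1 + e + δ) / δ) / (1 + e))) =
    ∫⁻ z in Ioi (0:ℝ), ENNReal.ofReal (w3L z * (Real.log (1 + e / (1 + e) ^ 2 / (z * (1 + z))) / e))
    := by
  have hk : 0 < 1 + e := by positivity
  rw [w3_scale hk]
  refine setLIntegral_congr_fun measurableSet_Ioi fun z hz => ?_
  have hz : 0 < z := hz
  beta_reduce
  rw [← ENNReal.ofReal_mul hk.le, w3L]
  have h1 : e / ((1 + e) * z * (1 + e + (1 + e) * z)) = e / (1 + e) ^ 2 / (z * (1 + z)) := by
    rw [show 1 + e + (1 + e) * z = (1 + e) * (1 + z) by ring]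
    field_simp
  have h2 : (1 + e + (1 + e) * z) / ((1 + e) * z) = (1 + z) / z := by
    rw [show 1 + e + (1 + e) * z = (1 + e) * (1 + z) by ring]
    field_simp
  rw [h1, h2]
  congr 1
  field_simp

open Set in
lemma w3_stepF {z : ℝ} (hz : 0 < z) :
    ∫⁻ e in Ioi (0:ℝ), ENNReal.ofReal (w3L z *
      (Real.log (1 + e / (1 + e) ^ 2 / (z * (1 + z))) / e)) = ENNReal.ofReal (w3L z ^ 3) := by
  have h0 := (w3L_pos hz).le
  simp_rw [ENNReal.ofReal_mul h0]
  rw [lintegral_const_mul' _ _ ENNReal.ofReal_ne_top, show w3L z ^ 3 = w3L z * w3L z ^ 2 by ring,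
    ENNReal.ofReal_mul h0, ← w3_intL hz]
  congr 1
  calc _ = ∫⁻ e in Ioi (0:ℝ), ∫⁻ y in Ioi z, ENNReal.ofReal ((1 + 2 * y) / (y * (1 + y)) *
      ((y * e + (1 + y)) * ((1 + y) * e + y))⁻¹) := by
        refine setLIntegral_congr_fun measurableSet_Ioi fun e he => ?_
        have he : 0 < e := he
        have hi : 0 ≤ e⁻¹ := by positivity
        beta_reduce
        rw [div_eq_inv_mul, ENNReal.ofReal_mul hi, ← w3_intlog hz (by positivity),
          ← lintegral_const_mul' _ _ ENNReal.ofReal_ne_top]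
        refine setLIntegral_congr_fun measurableSet_Ioi fun y hy => ?_
        have hy : 0 < y := lt_trans hz hy
        beta_reduce
        rw [← ENNReal.ofReal_mul hi]
        congr 1
        have h1 : (y * e + (1 + y)) * ((1 + y) * e + y) = (1 + e) ^ 2 *
          (y * (1 + y) + e / (1 + e) ^ 2) := by field_simp; ring
        rw [h1]
        have h2 : 0 < y * (1 + y) + e / (1 + e) ^ 2 := by positivity
        generalize y * (1 + y) + e / (1 + e) ^ 2 = w at h2
        field_simp
    _ = _ := by
        rw [lintegral_lintegral_swap (by fun_prop)]
        refine setLIntegral_congr_fun measurableSet_Ioi fun y hy => ?_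
        exact w3_inte (lt_trans hz hy)

theorem stmt18 :
    ∫ x : Fin 5 → ℝ in {x | ∀ i, 0 < x i},
      ((x 0 * x 1 + x 1 * x 2 + x 1 * x 4 + x 0 * x 2 + x 0 * x 3 + x 2 * x 3 +
          x 0 * x 4 + x 3 * x 4 +
          x 0 * x 1 * x 3 + x 1 * x 2 * x 3 + x 0 * x 1 * x 4 + x 1 * x 2 * x 4 +
          x 1 * x 3 * x 4 + x 0 * x 2 * x 3 + x 0 * x 2 * x 4 + x 2 * x 3 * x 4) ^ 2)⁻¹ =
      6 * ∑' n : ℕ, 1 / ((n : ℝ) + 1) ^ 3 := by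
  rw [integral_eq_lintegral_of_nonneg_ae (ae_of_all _ fun x => by positivity)
    (Measurable.aestronglyMeasurable (by fun_prop)), w3_iter _ (by fun_prop)]
  have hnn : 0 ≤ 6 * ∑' n : ℕ, 1 / ((n : ℝ) + 1) ^ 3 :=
    mul_nonneg (by norm_num) (tsum_nonneg fun n => by positivity)
  rw [← ENNReal.toReal_ofReal hnn]
  congr 1
  rw [← w3_last]
  calc _ = ∫⁻ e in Set.Ioi (0:ℝ), ∫⁻ z in Set.Ioi (0:ℝ), ENNReal.ofReal (w3L z *
        (Real.log (1 + e / (1 + e) ^ 2 / (z * (1 + z))) / e)) := by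
        refine setLIntegral_congr_fun measurableSet_Ioi fun e he => ?_
        beta_reduce
        rw [← w3_stepE he, ← w3_stepD he]
        refine setLIntegral_congr_fun measurableSet_Ioi fun d hd => ?_
        beta_reduce
        rw [← w3_stepC hd he]
        refine setLIntegral_congr_fun measurableSet_Ioi fun c hc => ?_
        exact w3_stepAB hc hd he
    _ = _ := by
        rw [lintegral_lintegral_swap (by fun_prop)]
        exact setLIntegral_congr_fun measurableSet_Ioi fun z hz => w3_stepF hz
end

section
/- Let e_1,e_2,e_3,e_4 be the standard basis vectors of ℝ⁴ and 𝟙 = (1,1,1,1). For all t₁, t₂ ∈ ℕ, the number of points of ℤ⁴ lying in the Minkowski sum t₁·conv{e_1,e_2,e_3,e_4} + t₂·conv{𝟙−e_1, 𝟙−e_2, 𝟙−e_3, 𝟙−e_4} equals 1 + t₁t₂ + (11/6)(t₁+t₂) + t₁t₂(t₁+t₂) + (t₁+t₂)² + (1/6)(t₁+t₂)³, as an identity of rational numbers. -/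
open Pointwise

lemma aux_smul (t : ℕ) : (t : ℝ) • stdSimplex ℝ (Fin 4) =
    {a : Fin 4 → ℝ | (∀ i, 0 ≤ a i) ∧ ∑ i, a i = t} := by
  ext a
  rw [Set.mem_smul_set]
  constructor
  · rintro ⟨u, ⟨hu0, hu1⟩, rfl⟩
    refine ⟨fun i => mul_nonneg (Nat.cast_nonneg _) (hu0 i), ?_⟩
    simp [← Finset.mul_sum, hu1]
  · rintro ⟨h0, h1⟩
    rcases Nat.eq_zero_or_pos t with rfl | ht
    · refine ⟨Pi.single 0 1, single_mem_stdSimplex ℝ 0, ?_⟩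
      have h1' : ∑ i, a i = 0 := by simpa using h1
      rw [Finset.sum_eq_zero_iff_of_nonneg (fun i _ => h0 i)] at h1'
      ext i
      simp [h1' i (Finset.mem_univ i)]
    · have ht' : (t : ℝ) ≠ 0 := by positivity
      refine ⟨(t : ℝ)⁻¹ • a, ⟨fun i => mul_nonneg (by positivity) (h0 i), ?_⟩, ?_⟩
      · simp [← Finset.mul_sum, h1, ht']
      · rw [smul_smul, mul_inv_cancel₀ ht', one_smul]

lemma aux_hull1 : convexHull ℝ (Set.range fun i : Fin 4 => (Pi.single i 1 : Fin 4 → ℝ)) =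
    stdSimplex ℝ (Fin 4) := convexHull_rangle_single_eq_stdSimplex ℝ (Fin 4)

lemma aux_hull2 : convexHull ℝ (Set.range fun i : Fin 4 =>
        (fun _ => 1 : Fin 4 → ℝ) - (Pi.single i 1 : Fin 4 → ℝ)) =
    {(fun _ => 1 : Fin 4 → ℝ)} - stdSimplex ℝ (Fin 4) := by
  rw [← aux_hull1, ← convexHull_singleton (𝕜 := ℝ) (fun _ => 1 : Fin 4 → ℝ), ← convexHull_sub]
  congr 1
  ext x
  simp

lemma aux_mem (s t : ℕ) (x : Fin 4 → ℝ) :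
    x ∈ (s : ℝ) • stdSimplex ℝ (Fin 4) +
      (t : ℝ) • ({(fun _ => 1 : Fin 4 → ℝ)} - stdSimplex ℝ (Fin 4)) ↔
    ∃ a b : Fin 4 → ℝ, (∀ i, 0 ≤ a i) ∧ ∑ i, a i = s ∧ (∀ i, 0 ≤ b i) ∧ ∑ i, b i = t ∧
      ∀ i, x i = a i + t - b i := by
  have hsub : (t : ℝ) • ({(fun _ => 1 : Fin 4 → ℝ)} - stdSimplex ℝ (Fin 4)) =
      (t : ℝ) • {(fun _ => 1 : Fin 4 → ℝ)} - (t : ℝ) • stdSimplex ℝ (Fin 4) := by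
    rw [sub_eq_add_neg, smul_add, Set.smul_set_neg, ← sub_eq_add_neg]
  rw [hsub, aux_smul, aux_smul, Set.mem_add]
  constructor
  · rintro ⟨a, ⟨ha, ha'⟩, y, hy, rfl⟩
    rw [Set.mem_sub] at hy
    obtain ⟨z, hz, b, ⟨hb, hb'⟩, rfl⟩ := hy
    rw [Set.smul_set_singleton, Set.mem_singleton_iff] at hz
    subst hz
    refine ⟨a, b, ha, ha', hb, hb', fun i => ?_⟩
    simp
    ring
  · rintro ⟨a, b, ha, ha', hb, hb', h⟩
    refine ⟨a, ⟨ha, ha'⟩, _, Set.sub_mem_sub (Set.smul_mem_smul_set (Set.mem_singleton _))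
      ⟨hb, hb'⟩, ?_⟩
    ext i
    simp [h i]
    ring

/-- lattice points, in coordinates -/
noncomputable def auxS (s t : ℤ) : Finset (Σ _ : ℤ, Σ _ : ℤ, ℤ) :=
  (Finset.Icc (-t) s).sigma fun a =>
    (Finset.Icc (-(t - max (-a) 0)) (s - max a 0)).sigma fun b =>
      Finset.Icc (-(t - max (-a) 0 - max (-b) 0)) (s - max a 0 - max b 0)

def auxF (s : ℤ) (t : ℤ) (p : Σ _ : ℤ, Σ _ : ℤ, ℤ) : Fin 4 → ℝ :=
  ![((p.1 + t : ℤ) : ℝ), ((p.2.1 + t : ℤ) : ℝ), ((p.2.2 + t : ℤ) : ℝ),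
    ((s - p.1 - p.2.1 - p.2.2 : ℤ) : ℝ)]

lemma auxF_inj (s t : ℤ) : Function.Injective (auxF s t) := by
  rintro ⟨a, b, c⟩ ⟨a', b', c'⟩ h
  have h0 := congrFun h 0
  have h1 := congrFun h 1
  have h2 := congrFun h 2
  simp [auxF] at h0 h1 h2
  subst h0 h1 h2
  rfl

lemma aux_memS (s t : ℕ) (a b c : ℤ) : (⟨a, b, c⟩ : Σ _ : ℤ, Σ _ : ℤ, ℤ) ∈ auxS s t ↔
    max a 0 + max b 0 + max c 0 ≤ s ∧ max (-a) 0 + max (-b) 0 + max (-c) 0 ≤ t := by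
  simp only [auxS, Finset.mem_sigma, Finset.mem_Icc]
  omega

lemma aux_set (s t : ℕ) :
    {x : Fin 4 → ℝ | x ∈ (s : ℝ) • stdSimplex ℝ (Fin 4) +
      (t : ℝ) • ({(fun _ => 1 : Fin 4 → ℝ)} - stdSimplex ℝ (Fin 4)) ∧
        ∀ i, ∃ m : ℤ, x i = (m : ℝ)} = auxF s t '' (auxS s t : Set _) := by
  ext x
  rw [Set.mem_ofPred_eq, aux_mem]
  constructor
  · rintro ⟨⟨u, v, hu, hu', hv, hv', h⟩, hm⟩
    choose m hm using hm
    simp only [Fin.sum_univ_four] at hu' hv'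
    have key : ∀ i, (m i : ℝ) = u i + t - v i := fun i => by rw [← hm, h]
    have h1 : ∀ i, ((max (m i - t) 0 : ℤ) : ℝ) ≤ u i := fun i => by
      push_cast
      exact max_le (by linarith [key i, hv i]) (hu i)
    have h2 : ∀ i, ((max (-(m i - t)) 0 : ℤ) : ℝ) ≤ v i := fun i => by
      push_cast
      exact max_le (by linarith [key i, hu i]) (hv i)
    refine ⟨⟨m 0 - t, m 1 - t, m 2 - t⟩, ?_, ?_⟩
    · rw [Finset.mem_coe, aux_memS]
      constructor
      · have : ((max (m 0 - t) 0 + max (m 1 - t) 0 + max (m 2 - t) 0 : ℤ) : ℝ) ≤ ((s : ℤ) : ℝ) := by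
          rw [Int.cast_add, Int.cast_add, Int.cast_natCast]
          linarith [h1 0, h1 1, h1 2, hu 3]
        exact Int.cast_le.mp this
      · have : ((max (-(m 0 - t)) 0 + max (-(m 1 - t)) 0 + max (-(m 2 - t)) 0 : ℤ) : ℝ)
            ≤ ((t : ℤ) : ℝ) := by
          rw [Int.cast_add, Int.cast_add, Int.cast_natCast]
          linarith [h2 0, h2 1, h2 2, hv 3]
        exact Int.cast_le.mp this
    · ext i
      have k0 := key 0
      have k1 := key 1
      have k2 := key 2
      have k3 := key 3
      fin_cases i <;> simp [auxF, hm] <;> linarith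
  · rintro ⟨⟨a, b, c⟩, hp, rfl⟩
    rw [Finset.mem_coe, aux_memS] at hp
    obtain ⟨hp1, hp2⟩ := hp
    refine ⟨?_, ?_⟩
    · let d : ℤ := s - t - a - b - c
      let e : ℤ := s - (max a 0 + max b 0 + max c 0 + max d 0)
      have he : 0 ≤ e := by simp only [e, d]; omega
      refine ⟨![((max a 0 + e : ℤ) : ℝ), ((max b 0 : ℤ) : ℝ), ((max c 0 : ℤ) : ℝ),
        ((max d 0 : ℤ) : ℝ)], ![((max (-a) 0 + e : ℤ) : ℝ), ((max (-b) 0 : ℤ) : ℝ),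
        ((max (-c) 0 : ℤ) : ℝ), ((max (-d) 0 : ℤ) : ℝ)], ?_, ?_, ?_, ?_, ?_⟩
      · intro i
        fin_cases i <;> refine Int.cast_nonneg (R := ℝ) ?_ <;> omega
      · simp only [Fin.sum_univ_four]
        change ((max a 0 + e : ℤ) : ℝ) + ((max b 0 : ℤ) : ℝ) + ((max c 0 : ℤ) : ℝ) +
          ((max d 0 : ℤ) : ℝ) = ((s : ℤ) : ℝ)
        rw [← Int.cast_add, ← Int.cast_add, ← Int.cast_add, Int.cast_inj]
        omega
      · intro i
        fin_cases i <;> refine Int.cast_nonneg (R := ℝ) ?_ <;> omega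
      · simp only [Fin.sum_univ_four]
        change ((max (-a) 0 + e : ℤ) : ℝ) + ((max (-b) 0 : ℤ) : ℝ) + ((max (-c) 0 : ℤ) : ℝ) +
          ((max (-d) 0 : ℤ) : ℝ) = ((t : ℤ) : ℝ)
        rw [← Int.cast_add, ← Int.cast_add, ← Int.cast_add, Int.cast_inj]
        omega
      · have hh : ∀ p q r : ℤ, p = q + t - r → (p : ℝ) = (q : ℝ) + (t : ℝ) - (r : ℝ) := by
          rintro p q r rfl
          push_cast
          ring
        intro i
        fin_cases i <;> refine hh _ _ _ ?_ <;> dsimp only <;> omega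
    · intro i
      fin_cases i <;> exact ⟨_, rfl⟩

lemma aux_split (f : ℤ → ℚ) (s t : ℕ) : ∑ a ∈ Finset.Icc (-(t : ℤ)) s, f a =
    ∑ k ∈ Finset.range (s + 1), f k + ∑ k ∈ Finset.range t, f (-((k : ℤ) + 1)) := by
  induction s with
  | zero =>
    induction t with
    | zero => simp
    | succ t ih =>
      have : Finset.Icc (-((t + 1 : ℕ) : ℤ)) ((0 : ℕ) : ℤ) =
          insert (-((t : ℤ) + 1)) (Finset.Icc (-(t : ℤ)) ((0 : ℕ) : ℤ)) := by
        ext x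
        simp only [Finset.mem_Icc, Finset.mem_insert]
        omega
      rw [this, Finset.sum_insert (by simp), ih, Finset.sum_range_succ _ t]
      ring
  | succ s ih =>
    have : Finset.Icc (-(t : ℤ)) ((s + 1 : ℕ) : ℤ) =
        insert ((s + 1 : ℕ) : ℤ) (Finset.Icc (-(t : ℤ)) (s : ℤ)) := by
      ext x
      simp only [Finset.mem_Icc, Finset.mem_insert]
      omega
    rw [this, Finset.sum_insert (by simp), ih, Finset.sum_range_succ _ (s + 1)]
    ring

/-- polynomial in dimension 2 -/
def auxG (s t : ℚ) : ℚ := ((s + 1) * (s + 2) + t * (t + 1)) / 2 + (s + 1) * t + s * t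

lemma aux_sum2 (s t : ℤ) (hs : 0 ≤ s) (ht : 0 ≤ t) :
    ∑ b ∈ Finset.Icc (-t) s,
      ((Finset.Icc (-(t - max (-b) 0)) (s - max b 0)).card : ℚ) = auxG s t := by
  lift s to ℕ using hs
  lift t to ℕ using ht
  have : ∀ b ∈ Finset.Icc (-(t : ℤ)) (s : ℤ),
      ((Finset.Icc (-(t - max (-b) 0)) (s - max b 0)).card : ℚ) =
        (s : ℚ) + t + 1 - ((max b 0 : ℤ) : ℚ) - ((max (-b) 0 : ℤ) : ℚ) := by
    intro b hb
    rw [Finset.mem_Icc] at hb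
    rw [Int.card_Icc]
    have : (((s - max b 0 + 1 - -(t - max (-b) 0) : ℤ).toNat : ℤ)) =
      (s + t + 1 - max b 0 - max (-b) 0 : ℤ) := by omega
    have := congrArg (Int.cast : ℤ → ℚ) this
    rw [Int.cast_natCast] at this
    rw [this, Int.cast_sub, Int.cast_sub]
    push_cast
    ring
  rw [Finset.sum_congr rfl this, aux_split]
  have e1 : ∀ k : ℕ, max (k : ℤ) 0 = k := fun k => by omega
  have e2 : ∀ k : ℕ, max (-(k : ℤ)) 0 = 0 := fun k => by omega
  have e3 : ∀ k : ℕ, max (-((k : ℤ) + 1)) 0 = 0 := fun k => by omega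
  have e4 : ∀ k : ℕ, max (- -((k : ℤ) + 1)) 0 = k + 1 := fun k => by omega
  simp only [e1, e2, e3, e4]
  have A : ∀ (c : ℚ) (n : ℕ), ∑ k ∈ Finset.range n, (c - ((k : ℤ) : ℚ) - ((0 : ℤ) : ℚ)) =
      c * n - n * (n - 1) / 2 := by
    intro c n
    induction n with
    | zero => simp
    | succ n ih => rw [Finset.sum_range_succ, ih]; push_cast; ring
  have B : ∀ (c : ℚ) (n : ℕ), ∑ k ∈ Finset.range n, (c - ((0 : ℤ) : ℚ) - (((k : ℤ) + 1 : ℤ) : ℚ)) =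
      c * n - n * (n + 1) / 2 := by
    intro c n
    induction n with
    | zero => simp
    | succ n ih => rw [Finset.sum_range_succ, ih]; push_cast; ring
  rw [A, B]
  simp only [auxG]
  push_cast
  ring

lemma aux_card (s t : ℕ) : ((auxS s t).card : ℚ) =
      1 + (s : ℚ) * t + 11 / 6 * ((s : ℚ) + t) + (s : ℚ) * t * ((s : ℚ) + t) +
        ((s : ℚ) + t) ^ 2 + 1 / 6 * ((s : ℚ) + t) ^ 3 := by
  simp only [auxS, Finset.card_sigma]
  simp only [Nat.cast_sum]
  rw [Finset.sum_congr rfl (fun a ha => aux_sum2 (s - max a 0) (t - max (-a) 0)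
    (by rw [Finset.mem_Icc] at ha; omega) (by rw [Finset.mem_Icc] at ha; omega)), aux_split]
  have e1 : ∀ k : ℕ, max (k : ℤ) 0 = k := fun k => by omega
  have e2 : ∀ k : ℕ, max (-(k : ℤ)) 0 = 0 := fun k => by omega
  have e3 : ∀ k : ℕ, max (-((k : ℤ) + 1)) 0 = 0 := fun k => by omega
  have e4 : ∀ k : ℕ, max (- -((k : ℤ) + 1)) 0 = k + 1 := fun k => by omega
  simp only [e1, e2, e3, e4]
  have P : ∀ n : ℕ, ∑ k ∈ Finset.range n, (k : ℚ) = n * (n - 1) / 2 := by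
    intro n
    induction n with
    | zero => simp
    | succ n ih => rw [Finset.sum_range_succ, ih]; push_cast; ring
  have Q : ∀ n : ℕ, ∑ k ∈ Finset.range n, (k : ℚ) ^ 2 = n * (n - 1) * (2 * n - 1) / 6 := by
    intro n
    induction n with
    | zero => simp
    | succ n ih => rw [Finset.sum_range_succ, ih]; push_cast; ring
  have R : ∀ (c d e : ℚ) (n : ℕ), ∑ k ∈ Finset.range n, (c + d * k + e * (k : ℚ) ^ 2) =
      c * n + d * (n * (n - 1) / 2) + e * (n * (n - 1) * (2 * n - 1) / 6) := by
    intro c d e n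
    rw [Finset.sum_add_distrib, Finset.sum_add_distrib, ← Finset.mul_sum, ← Finset.mul_sum, P, Q]
    simp
    ring
  have A : ∀ k : ℕ, auxG ((s - k : ℤ) : ℚ) ((t - 0 : ℤ) : ℚ) =
      auxG s t + (-(s : ℚ) - 3 / 2 - 2 * t) * k + (1 / 2) * (k : ℚ) ^ 2 := by
    intro k
    simp only [auxG]
    push_cast
    ring
  have B : ∀ k : ℕ, auxG ((s - 0 : ℤ) : ℚ) ((t - (k + 1) : ℤ) : ℚ) =
      auxG s (t - 1) + (-(t : ℚ) - 1 / 2 - 2 * s) * k + (1 / 2) * (k : ℚ) ^ 2 := by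
    intro k
    simp only [auxG]
    push_cast
    ring
  simp only [A, B, R]
  simp only [auxG]
  push_cast
  ring

/-- The bivariate Ehrhart polynomial of the three-loop sunset Newton
polytope: for `t₁, t₂ ∈ ℕ`, the number of integer points in
`t₁·conv{e₁,e₂,e₃,e₄} + t₂·conv{𝟙−e₁,…,𝟙−e₄} ⊆ ℝ⁴` equals
`1 + t₁t₂ + (11/6)(t₁+t₂) + t₁t₂(t₁+t₂) + (t₁+t₂)² + (1/6)(t₁+t₂)³`. -/
theorem stmt19 (t₁ t₂ : ℕ) :
    let Δ₁ : Set (Fin 4 → ℝ) :=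
      convexHull ℝ (Set.range fun i : Fin 4 => (Pi.single i 1 : Fin 4 → ℝ))
    let Δ₂ : Set (Fin 4 → ℝ) :=
      convexHull ℝ (Set.range fun i : Fin 4 =>
        (fun _ => 1 : Fin 4 → ℝ) - (Pi.single i 1 : Fin 4 → ℝ))
    (({x : Fin 4 → ℝ |
        x ∈ (t₁ : ℝ) • Δ₁ + (t₂ : ℝ) • Δ₂ ∧ ∀ i, ∃ m : ℤ, x i = (m : ℝ)}).ncard : ℚ) =
      1 + (t₁ : ℚ) * t₂ + 11 / 6 * ((t₁ : ℚ) + t₂) + (t₁ : ℚ) * t₂ * ((t₁ : ℚ) + t₂) +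
        ((t₁ : ℚ) + t₂) ^ 2 + 1 / 6 * ((t₁ : ℚ) + t₂) ^ 3 := by
  intro Δ₁ Δ₂
  simp only [Δ₁, Δ₂]
  rw [aux_hull1, aux_hull2, aux_set, Set.ncard_image_of_injective _ (auxF_inj _ _),
    Set.ncard_coe_finset, aux_card]
end
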